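/- Let (R, m, k) be a Cohen–Macaulay local ring of dimension d with canonical module ω_R. Let M and N be finitely generated R-modules of finite Gorenstein dimension such that Êxt^i_R(M,N) has finite length for all i ∈ ℤ. Then Êxt^i_R(M,N) ≅ Hom_R(Êxt^{d−i−1}_R(N, M ⊗_R ω_R), E_R(k)) for all i ∈ ℤ, where E_R(k) is the injective envelope of the residue field k. -/

import Mathlib

open CategoryTheory CategoryTheory.Limits CategoryTheory.MonoidalCategory Opposite

noncomputable section

universe u

variable (R : Type u) [CommRing R]

/-- Ordinary `Ext` of `R`-modules, via the derived functor `Ext` of Mathlib. -/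
abbrev ExtMod (n : ℕ) (M N : ModuleCat.{u} R) : ModuleCat.{u} R :=
  ((Ext R (ModuleCat.{u} R) n).obj (op M)).obj N

/-- Ordinary `Tor` of `R`-modules, via the derived functor `Tor` of Mathlib. -/
abbrev TorMod (n : ℕ) (M N : ModuleCat.{u} R) : ModuleCat.{u} R :=
  ((Tor (ModuleCat.{u} R) n).obj M).obj N

/-- A finitely generated module `M` is totally reflexive (of G-dimension zero) if the
biduality map is an isomorphism and `Ext^i(M,R) = 0 = Ext^i(M^*,R)` for all `i > 0`. -/
def IsTotallyReflexive (M : ModuleCat.{u} R) : Prop :=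
  Module.Finite R M ∧
  Function.Bijective (Module.Dual.eval R M) ∧
  (∀ i : ℕ, 0 < i → IsZero (ExtMod R i M (ModuleCat.of R R))) ∧
  (∀ i : ℕ, 0 < i → IsZero (ExtMod R i (ModuleCat.of R (Module.Dual R M)) (ModuleCat.of R R)))

/-- `M` admits a resolution `0 → G_n → ⋯ → G_0 → M → 0` by totally reflexive modules. -/
def GDimLE (M : ModuleCat.{u} R) (n : ℕ) : Prop :=
  ∃ (G : ChainComplex (ModuleCat.{u} R) ℕ) (ε : G.X 0 ⟶ M),
    (∀ i, i ≤ n → IsTotallyReflexive R (G.X i)) ∧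
    (∀ i, n < i → IsZero (G.X i)) ∧
    Epi ε ∧
    (∃ w : G.d 1 0 ≫ ε = 0, (ShortComplex.mk (G.d 1 0) ε w).Exact) ∧
    (∀ i, 0 < i → G.ExactAt i)

/-- `M` has finite Gorenstein dimension. -/
def HasFiniteGDim (M : ModuleCat.{u} R) : Prop := ∃ n, GDimLE R M n

/-- The Gorenstein dimension of `M`, as an element of `ℕ∞`. -/
def gdim (M : ModuleCat.{u} R) : ℕ∞ :=
  sInf {c : ℕ∞ | ∃ n : ℕ, c = n ∧ GDimLE R M n}

/-- `M` admits a projective resolution of length at most `n`. -/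
def PdLE (M : ModuleCat.{u} R) (n : ℕ) : Prop :=
  ∃ (G : ChainComplex (ModuleCat.{u} R) ℕ) (ε : G.X 0 ⟶ M),
    (∀ i, Projective (G.X i)) ∧
    (∀ i, n < i → IsZero (G.X i)) ∧
    Epi ε ∧
    (∃ w : G.d 1 0 ≫ ε = 0, (ShortComplex.mk (G.d 1 0) ε w).Exact) ∧
    (∀ i, 0 < i → G.ExactAt i)

/-- `M` has finite projective dimension. -/
def HasFinitePd (M : ModuleCat.{u} R) : Prop := ∃ n, PdLE R M n

/-- The projective dimension of `M`, as an element of `ℕ∞`. -/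
def pdim (M : ModuleCat.{u} R) : ℕ∞ :=
  sInf {c : ℕ∞ | ∃ n : ℕ, c = n ∧ PdLE R M n}

/-- `M` admits an injective resolution `0 → M → I^0 → ⋯ → I^n → 0`. -/
def InjDimLE (M : ModuleCat.{u} R) (n : ℕ) : Prop :=
  ∃ (I : CochainComplex (ModuleCat.{u} R) ℕ) (ι : M ⟶ I.X 0),
    (∀ i, Injective (I.X i)) ∧
    (∀ i, n < i → IsZero (I.X i)) ∧
    Mono ι ∧
    (∃ w : ι ≫ I.d 0 1 = 0, (ShortComplex.mk ι (I.d 0 1) w).Exact) ∧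
    (∀ i, 0 < i → I.ExactAt i)

/-- `M` has finite injective dimension. -/
def HasFiniteInjDim (M : ModuleCat.{u} R) : Prop := ∃ n, InjDimLE R M n

/-- A Gorenstein local ring: a commutative Noetherian local ring of finite self-injective
dimension. -/
def IsGorensteinLocalRing : Prop :=
  IsLocalRing R ∧ IsNoetherianRing R ∧ HasFiniteInjDim R (ModuleCat.of R R)

/-- The grade of a module: `grade M = inf { i | Ext^i(M,R) ≠ 0 }`. -/
def gradeM (M : ModuleCat.{u} R) : ℕ∞ :=
  sInf {c : ℕ∞ | ∃ i : ℕ, c = i ∧ ¬ IsZero (ExtMod R i M (ModuleCat.of R R))}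

/-- A module is G-perfect if its grade equals its Gorenstein dimension. -/
def IsGPerfect (M : ModuleCat.{u} R) : Prop := gradeM R M = gdim R M

/-- An ideal `c` is perfect if `grade (R/c) = pd (R/c)`. -/
def IsPerfectIdeal (c : Ideal R) : Prop :=
  gradeM R (ModuleCat.of R (R ⧸ c)) = pdim R (ModuleCat.of R (R ⧸ c))

/-- A complete resolution `T → P → M` of `M`: `P → M` is a resolution by finite projective
modules, `T` is a totally acyclic complex of finite projective modules, and `θ i` is an
isomorphism for all `i ≫ 0`. -/
structure CompleteResolution (M : ModuleCat.{u} R) where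
  T : ChainComplex (ModuleCat.{u} R) ℤ
  P : ChainComplex (ModuleCat.{u} R) ℤ
  θ : T ⟶ P
  π : P.X 0 ⟶ M
  projT : ∀ i, Projective (T.X i)
  fgT : ∀ i, Module.Finite R (T.X i)
  projP : ∀ i, Projective (P.X i)
  fgP : ∀ i, Module.Finite R (P.X i)
  zeroP : ∀ i : ℤ, i < 0 → IsZero (P.X i)
  epiπ : Epi π
  wπ : P.d 1 0 ≫ π = 0
  exact0 : (ShortComplex.mk (P.d 1 0) π wπ).Exact
  exactP : ∀ i : ℤ, 0 < i → P.ExactAt i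
  exactT : ∀ i : ℤ, T.ExactAt i
  exactTdual : ∀ i : ℤ, (T.linearYonedaObj R (ModuleCat.of R R)).ExactAt i
  iso_eventually : ∃ n₀ : ℤ, ∀ i : ℤ, n₀ ≤ i → IsIso (θ.f i)

/-- Tate cohomology `Êxt^i(M,N) = H^i(Hom(T,N))` computed from a complete resolution of `M`. -/
def TateExt {M : ModuleCat.{u} R} (C : CompleteResolution R M) (N : ModuleCat.{u} R)
    (i : ℤ) : ModuleCat.{u} R :=
  (C.T.linearYonedaObj R N).homology i

/-- Tate homology `T̂or_i(M,N) = H_i(T ⊗ N)` computed from a complete resolution of `M`. -/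
def TateTor {M : ModuleCat.{u} R} (C : CompleteResolution R M) (N : ModuleCat.{u} R)
    (i : ℤ) : ModuleCat.{u} R :=
  ((((tensoringRight (ModuleCat.{u} R)).obj N).mapHomologicalComplex _).obj C.T).homology i

/-- The depth of a module over a local ring: the supremum of the lengths of the
`M`-regular sequences contained in the maximal ideal. -/
def moduleDepth [IsLocalRing R] (M : Type u) [AddCommGroup M] [Module R M] : ℕ∞ :=
  sSup {c : ℕ∞ | ∃ rs : List R, c = rs.length ∧
    (∀ r ∈ rs, r ∈ IsLocalRing.maximalIdeal R) ∧ RingTheory.Sequence.IsRegular M rs}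

/-- `E` is an injective envelope of the residue field `k`: an injective module which is an
essential extension of `k`. -/
def IsInjectiveEnvelopeOfResidueField [IsLocalRing R] (E : Type u) [AddCommGroup E]
    [Module R E] : Prop :=
  Injective (ModuleCat.of R E) ∧
  ∃ ι : IsLocalRing.ResidueField R →ₗ[R] E,
    Function.Injective ι ∧
    ∀ N : Submodule R E, N ≠ ⊥ → N ⊓ LinearMap.range ι ≠ ⊥


/-- A minimal free resolution `⋯ → F_1 → F_0 → M → 0` of a finitely generated module over a
local ring, recorded by its Betti numbers `b n` and differentials with image inside
`m • F_n`. -/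
structure MinFreeRes [IsLocalRing R] (M : Type u) [AddCommGroup M] [Module R M] where
  b : ℕ → ℕ
  d : ∀ n : ℕ, ((Fin (b (n+1)) → R) →ₗ[R] (Fin (b n) → R))
  aug : (Fin (b 0) → R) →ₗ[R] M
  aug_surj : Function.Surjective aug
  exact_zero : LinearMap.ker aug = LinearMap.range (d 0)
  exact_succ : ∀ n, LinearMap.ker (d n) = LinearMap.range (d (n+1))
  minimal : ∀ n, LinearMap.range (d n) ≤ (IsLocalRing.maximalIdeal R) • ⊤

/-- The Betti numbers of `M` are eventually bounded by `γ · n^(c-1)`. -/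
def CxLE [IsLocalRing R] (M : Type u) [AddCommGroup M] [Module R M] (c : ℕ) : Prop :=
  ∃ (F : MinFreeRes R M) (γ : ℝ) (n₀ : ℕ),
    ∀ n : ℕ, n₀ ≤ n → (F.b n : ℝ) ≤ γ * (n : ℝ) ^ ((c : ℤ) - 1)

/-- The complexity of a module: the least `c` such that the Betti numbers are eventually
bounded by `γ · n^(c-1)` for some `γ`. -/
def complexity [IsLocalRing R] (M : Type u) [AddCommGroup M] [Module R M] : ℕ∞ :=
  sInf {e : ℕ∞ | ∃ c : ℕ, e = c ∧ CxLE R M c}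

/-- The pushout `K_η` of a map `f : Ω^{j+1} M → M` (representing a degree-`(j+1)`
homogeneous element `η` of `Ext^*(M,M)`) along the inclusion `Ω^{j+1} M ↪ F_j`: the
cokernel of `(f, -incl) : Ω^{j+1} M → M ⊕ F_j`. -/
abbrev PushoutMod [IsLocalRing R] {M : Type u} [AddCommGroup M] [Module R M]
    (F : MinFreeRes R M) (j : ℕ) (f : LinearMap.range (F.d j) →ₗ[R] M) : Type u :=
  (M × (Fin (F.b j) → R)) ⧸
    LinearMap.range (LinearMap.prod f (-(LinearMap.range (F.d j)).subtype))

/-- Auxiliary predicate: `M` has reducible complexity, with recursion depth `≤ c`. -/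
def RedCxAux [IsLocalRing R] :
    ℕ → ∀ (M : Type u) (_ : AddCommGroup M) (_ : Module R M), Prop
  | 0, M, g, m =>
      letI := g; letI := m
      HasFinitePd R (ModuleCat.of R M)
  | (c+1), M, g, m =>
      letI := g; letI := m
      HasFinitePd R (ModuleCat.of R M) ∨
      (complexity R M < ⊤ ∧ 0 < complexity R M ∧
        ∃ (j : ℕ) (F : MinFreeRes R M) (f : LinearMap.range (F.d j) →ₗ[R] M),
          complexity R (PushoutMod R F j f) < complexity R M ∧
          moduleDepth R (PushoutMod R F j f) = moduleDepth R M ∧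
          RedCxAux c (PushoutMod R F j f) inferInstance inferInstance)

/-- `M` has reducible complexity. -/
def HasReducibleComplexity [IsLocalRing R] (M : Type u) [AddCommGroup M] [Module R M] :
    Prop :=
  ∃ c : ℕ, RedCxAux R c M inferInstance inferInstance

/-- `L` is (isomorphic to) `λ N = Ω Tr N`, computed from a minimal free presentation of `N`
over the local ring `S`. -/
def IsLambdaOf (S : Type u) [CommRing S] [IsLocalRing S]
    (N L : Type u) [AddCommGroup N] [Module S N] [AddCommGroup L] [Module S L] : Prop :=
  ∃ (n₀ n₁ : ℕ) (g : (Fin n₀ → S) →ₗ[S] N) (f : (Fin n₁ → S) →ₗ[S] (Fin n₀ → S)),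
    Function.Surjective g ∧
    LinearMap.range f = LinearMap.ker g ∧
    LinearMap.ker g ≤ (IsLocalRing.maximalIdeal S) • ⊤ ∧
    LinearMap.ker f ≤ (IsLocalRing.maximalIdeal S) • ⊤ ∧
    Nonempty (L ≃ₗ[S] LinearMap.range f.dualMap)

/-- `M` and `N` are linked by the ideal `c`: both are annihilated by `c` (hence are
`R/c`-modules) and `M ≅ λ_{R/c} N`, `N ≅ λ_{R/c} M`. -/
def LinkedBy (c : Ideal R) (M N : Type u) [AddCommGroup M] [Module (R ⧸ c) M]
    [AddCommGroup N] [Module (R ⧸ c) N] [IsLocalRing (R ⧸ c)] : Prop :=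
  IsLambdaOf (R ⧸ c) N M ∧ IsLambdaOf (R ⧸ c) M N

namespace ARD

section extTools

variable {R : Type} [CommRing R]

/-- A short exact sequence of modules, unbundled. -/
structure SES {A B C : Type} [AddCommGroup A] [Module R A] [AddCommGroup B] [Module R B]
    [AddCommGroup C] [Module R C] (f : A →ₗ[R] B) (g : B →ₗ[R] C) : Prop where
  inj : Function.Injective f
  ex : Function.Exact f g
  surj : Function.Surjective g

variable {A B C X Y Z : Type} [AddCommGroup A] [Module R A] [AddCommGroup B] [Module R B]
    [AddCommGroup C] [Module R C] [AddCommGroup X] [Module R X] [AddCommGroup Y] [Module R Y]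
    [AddCommGroup Z] [Module R Z]

variable (R A B) in
/-- Unbundled Ext groups. -/
abbrev EX (n : ℕ) : Type := Abelian.Ext.{0} (ModuleCat.of R A) (ModuleCat.of R B) n

/-- The contravariant action. -/
def pre (f : A →ₗ[R] B) (Y : Type) [AddCommGroup Y] [Module R Y] (n : ℕ) :
    EX R B Y n →ₗ[R] EX R A Y n :=
  Abelian.Ext.bilinearCompOfLinear R _ _ _ 0 n n (zero_add n) (Abelian.Ext.mk₀ (ModuleCat.ofHom f))

/-- The covariant action. -/
def post (X : Type) [AddCommGroup X] [Module R X] (f : A →ₗ[R] B) (n : ℕ) :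
    EX R X A n →ₗ[R] EX R X B n :=
  (Abelian.Ext.bilinearCompOfLinear R _ _ _ n 0 n (add_zero n)).flip
    (Abelian.Ext.mk₀ (ModuleCat.ofHom f))

lemma pre_apply (f : A →ₗ[R] B) (n : ℕ) (x : EX R B Y n) :
    pre f Y n x = (Abelian.Ext.mk₀ (ModuleCat.ofHom f)).comp x (zero_add n) := rfl

lemma post_apply (f : A →ₗ[R] B) (n : ℕ) (x : EX R X A n) :
    post X f n x = x.comp (Abelian.Ext.mk₀ (ModuleCat.ofHom f)) (add_zero n) := rfl

lemma pre_id (n : ℕ) (x : EX R A Y n) : pre (LinearMap.id) Y n x = x := by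
  rw [pre_apply]; exact Abelian.Ext.mk₀_id_comp x

lemma post_id (n : ℕ) (x : EX R X A n) : post X (LinearMap.id) n x = x := by
  rw [post_apply]; exact Abelian.Ext.comp_mk₀_id x

lemma pre_pre (f : A →ₗ[R] B) (g : B →ₗ[R] C) (n : ℕ) (x : EX R C Y n) :
    pre f Y n (pre g Y n x) = pre (g ∘ₗ f) Y n x := by
  simp only [pre_apply, ModuleCat.ofHom_comp]
  rw [← Abelian.Ext.mk₀_comp_mk₀_assoc]

lemma post_post (f : A →ₗ[R] B) (g : B →ₗ[R] C) (n : ℕ) (x : EX R X A n) :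
    post X g n (post X f n x) = post X (g ∘ₗ f) n x := by
  simp only [post_apply, ModuleCat.ofHom_comp]
  rw [Abelian.Ext.comp_assoc_of_third_deg_zero, Abelian.Ext.mk₀_comp_mk₀]

lemma pre_sum {ι : Type} [Fintype ι] (f : ι → (A →ₗ[R] B)) (n : ℕ) (x : EX R B Y n) :
    pre (∑ i, f i) Y n x = ∑ i, pre (f i) Y n x := by
  simp only [pre_apply]
  rw [← Abelian.Ext.sum_comp, ← Abelian.Ext.mk₀_sum]
  congr 2
  ext; simp

lemma post_sum {ι : Type} [Fintype ι] (f : ι → (A →ₗ[R] B)) (n : ℕ) (x : EX R X A n) :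
    post X (∑ i, f i) n x = ∑ i, post X (f i) n x := by
  simp only [post_apply]
  rw [← Abelian.Ext.comp_sum, ← Abelian.Ext.mk₀_sum]
  congr 2
  ext; simp

/-- Isomorphism in the first variable. -/
def preEquiv (e : A ≃ₗ[R] B) (Y : Type) [AddCommGroup Y] [Module R Y] (n : ℕ) :
    EX R B Y n ≃ₗ[R] EX R A Y n :=
  LinearEquiv.ofLinearMap (pre e.toLinearMap Y n) (pre e.symm.toLinearMap Y n)
    (by ext x; simp [pre_pre, pre_id]) (by ext x; simp [pre_pre, pre_id])

/-- Isomorphism in the second variable. -/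
def postEquiv (X : Type) [AddCommGroup X] [Module R X] (e : A ≃ₗ[R] B) (n : ℕ) :
    EX R X A n ≃ₗ[R] EX R X B n :=
  LinearEquiv.ofLinearMap (post X e.toLinearMap n) (post X e.symm.toLinearMap n)
    (by ext x; simp [post_post, post_id]) (by ext x; simp [post_post, post_id])

/-- Degree zero. -/
def homE (A B : Type) [AddCommGroup A] [Module R A] [AddCommGroup B] [Module R B] :
    (A →ₗ[R] B) ≃ₗ[R] EX R A B 0 :=
  (show (A →ₗ[R] B) ≃ₗ[R] (ModuleCat.of R A ⟶ ModuleCat.of R B) from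
    (ModuleCat.homLinearEquiv (S := R) (M := ModuleCat.of R A) (N := ModuleCat.of R B)).symm).trans
    (Abelian.Ext.linearEquiv₀ (R := R) (X := ModuleCat.of R A) (Y := ModuleCat.of R B)).symm

lemma homE_apply (φ : A →ₗ[R] B) : homE A B φ = Abelian.Ext.mk₀ (ModuleCat.ofHom φ) := rfl

lemma pre_homE (f : A →ₗ[R] B) (φ : B →ₗ[R] Y) :
    pre f Y 0 (homE B Y φ) = homE A Y (φ ∘ₗ f) := by
  simp only [pre_apply, homE_apply, ModuleCat.ofHom_comp]
  exact Abelian.Ext.mk₀_comp_mk₀ _ _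

lemma post_homE (f : A →ₗ[R] B) (φ : X →ₗ[R] A) :
    post X f 0 (homE X A φ) = homE X B (f ∘ₗ φ) := by
  simp only [post_apply, homE_apply, ModuleCat.ofHom_comp]
  exact Abelian.Ext.mk₀_comp_mk₀ _ _

/-- The bundled short complex. -/
def SES.sc {f : A →ₗ[R] B} {g : B →ₗ[R] C} (h : SES f g) : ShortComplex (ModuleCat.{0} R) :=
  ShortComplex.mk (ModuleCat.ofHom f) (ModuleCat.ofHom g)
    (by ext x; simpa using h.ex.apply_apply_eq_zero x)

lemma SES.shortExact {f : A →ₗ[R] B} {g : B →ₗ[R] C} (h : SES f g) : h.sc.ShortExact := by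
  have hm : Mono h.sc.f := (ModuleCat.mono_iff_injective _).2 h.inj
  have he : Epi h.sc.g := (ModuleCat.epi_iff_surjective _).2 h.surj
  refine ShortComplex.ShortExact.mk ?_
  rw [ShortComplex.ShortExact.moduleCat_exact_iff_function_exact]
  exact h.ex

lemma sc_aux1 {S : ShortComplex (ModuleCat.{0} R)} (hS : S.ShortExact) {X : ModuleCat.{0} R} {n : ℕ}
    (y : Abelian.Ext.{0} X S.X₂ n) :
    (y.comp (Abelian.Ext.mk₀ S.g) (add_zero n)).comp hS.extClass rfl = 0 := by
  rw [Abelian.Ext.comp_assoc_of_second_deg_zero, hS.comp_extClass, Abelian.Ext.comp_zero]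

lemma sc_aux2 {S : ShortComplex (ModuleCat.{0} R)} (hS : S.ShortExact) {X : ModuleCat.{0} R} {n : ℕ}
    (y : Abelian.Ext.{0} X S.X₃ n) :
    (y.comp hS.extClass rfl).comp (Abelian.Ext.mk₀ S.f) (add_zero (n + 1)) = 0 := by
  rw [Abelian.Ext.comp_assoc_of_third_deg_zero, hS.extClass_comp, Abelian.Ext.comp_zero]

lemma SES.pre_exact {f : A →ₗ[R] B} {g : B →ₗ[R] C} (h : SES f g) (Y : Type) [AddCommGroup Y]
    [Module R Y] (n : ℕ) : Function.Exact (pre g Y n) (pre f Y n) := by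
  intro x
  constructor
  · intro hx
    exact Abelian.Ext.contravariant_sequence_exact₂ h.shortExact _ x hx
  · rintro ⟨y, rfl⟩
    rw [pre_pre, show g ∘ₗ f = 0 from by ext x; exact h.ex.apply_apply_eq_zero x, pre_apply]
    rw [show ModuleCat.ofHom (0 : A →ₗ[R] C) = 0 from rfl, Abelian.Ext.mk₀_zero,
      Abelian.Ext.zero_comp]

lemma SES.post_exact {f : A →ₗ[R] B} {g : B →ₗ[R] C} (h : SES f g) (X : Type) [AddCommGroup X]
    [Module R X] (n : ℕ) : Function.Exact (post X f n) (post X g n) := by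
  intro x
  constructor
  · intro hx
    exact Abelian.Ext.covariant_sequence_exact₂ _ h.shortExact x hx
  · rintro ⟨y, rfl⟩
    rw [post_post, show g ∘ₗ f = 0 from by ext x; exact h.ex.apply_apply_eq_zero x, post_apply]
    rw [show ModuleCat.ofHom (0 : A →ₗ[R] C) = 0 from rfl, Abelian.Ext.mk₀_zero,
      Abelian.Ext.comp_zero]

lemma SES.exists_pre {f : A →ₗ[R] B} {g : B →ₗ[R] C} (h : SES f g) (Y : Type) [AddCommGroup Y]
    [Module R Y] (n : ℕ) : ∃ δ : EX R A Y n →ₗ[R] EX R C Y (n + 1),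
      Function.Exact (pre f Y n) δ ∧ Function.Exact δ (pre g Y (n + 1)) := by
  refine ⟨Abelian.Ext.bilinearCompOfLinear R _ _ _ 1 n (n + 1) (add_comm 1 n)
    h.shortExact.extClass, ?_, ?_⟩
  · intro x
    constructor
    · intro hx
      exact Abelian.Ext.contravariant_sequence_exact₁ h.shortExact _ x (add_comm 1 n) hx
    · rintro ⟨y, rfl⟩
      exact h.shortExact.extClass_comp_assoc y (h := add_comm 1 n)
  · intro x
    constructor
    · intro hx
      exact Abelian.Ext.contravariant_sequence_exact₃ h.shortExact _ x hx (add_comm 1 n)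
    · rintro ⟨y, rfl⟩
      exact h.shortExact.comp_extClass_assoc y (add_comm 1 n)

lemma SES.exists_post {f : A →ₗ[R] B} {g : B →ₗ[R] C} (h : SES f g) (X : Type) [AddCommGroup X]
    [Module R X] (n : ℕ) : ∃ δ : EX R X C n →ₗ[R] EX R X A (n + 1),
      Function.Exact (post X g n) δ ∧ Function.Exact δ (post X f (n + 1)) := by
  refine ⟨(Abelian.Ext.bilinearCompOfLinear R _ _ _ n 1 (n + 1) rfl).flip
    h.shortExact.extClass, ?_, ?_⟩
  · intro x
    constructor
    · intro hx
      exact Abelian.Ext.covariant_sequence_exact₃ _ h.shortExact x rfl hx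
    · rintro ⟨y, rfl⟩
      exact sc_aux1 h.shortExact y
  · intro x
    constructor
    · intro hx
      exact Abelian.Ext.covariant_sequence_exact₁ _ h.shortExact x hx rfl
    · rintro ⟨y, rfl⟩
      exact sc_aux2 h.shortExact y

/-- the middle map is bijective when the outer terms vanish -/
lemma exact_bij {A B C D : Type} [AddCommGroup A] [Module R A] [AddCommGroup B] [Module R B]
    [AddCommGroup C] [Module R C] [AddCommGroup D] [Module R D]
    {f : A →ₗ[R] B} {g : B →ₗ[R] C} {h : C →ₗ[R] D}
    (h1 : Function.Exact f g) (h2 : Function.Exact g h) (hA : Subsingleton A)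
    (hD : Subsingleton D) : Nonempty (B ≃ₗ[R] C) := by
  refine ⟨LinearEquiv.ofBijective g ⟨?_, ?_⟩⟩
  · rw [injective_iff_map_eq_zero]
    intro x hx
    obtain ⟨y, rfl⟩ := (h1 x).1 hx
    rw [Subsingleton.elim y 0, map_zero]
  · intro y
    exact (h2 y).1 (Subsingleton.elim _ _)

lemma exact_sub {A B C : Type} [AddCommGroup A] [Module R A] [AddCommGroup B] [Module R B]
    [AddCommGroup C] [Module R C] {f : A →ₗ[R] B} {g : B →ₗ[R] C}
    (h1 : Function.Exact f g) (hA : Subsingleton A) (hC : Subsingleton C) : Subsingleton B := by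
  refine subsingleton_of_forall_eq 0 fun x => ?_
  obtain ⟨y, rfl⟩ := (h1 x).1 (Subsingleton.elim _ _)
  rw [Subsingleton.elim y 0, map_zero]

variable {f : A →ₗ[R] B} {g : B →ₗ[R] C}

lemma SES.shift_pre (h : SES f g) (Y : Type) [AddCommGroup Y] [Module R Y] (n : ℕ)
    (h1 : Subsingleton (EX R B Y n)) (h2 : Subsingleton (EX R B Y (n + 1))) :
    Nonempty (EX R A Y n ≃ₗ[R] EX R C Y (n + 1)) := by
  obtain ⟨δ, e1, e2⟩ := h.exists_pre Y n
  exact exact_bij e1 e2 h1 h2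

lemma SES.shift_post (h : SES f g) (X : Type) [AddCommGroup X] [Module R X] (n : ℕ)
    (h1 : Subsingleton (EX R X B n)) (h2 : Subsingleton (EX R X B (n + 1))) :
    Nonempty (EX R X C n ≃ₗ[R] EX R X A (n + 1)) := by
  obtain ⟨δ, e1, e2⟩ := h.exists_post X n
  exact exact_bij e1 e2 h1 h2

lemma SES.pre_iso_f (h : SES f g) (Y : Type) [AddCommGroup Y] [Module R Y] (n : ℕ)
    (h1 : Subsingleton (EX R C Y n)) (h2 : Subsingleton (EX R C Y (n + 1))) :
    Nonempty (EX R B Y n ≃ₗ[R] EX R A Y n) := by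
  obtain ⟨δ, e1, e2⟩ := h.exists_pre Y n
  exact exact_bij (h.pre_exact Y n) e1 h1 h2

lemma SES.pre_iso_g (h : SES f g) (Y : Type) [AddCommGroup Y] [Module R Y] (n : ℕ)
    (h1 : Subsingleton (EX R A Y n)) (h2 : Subsingleton (EX R A Y (n + 1))) :
    Nonempty (EX R C Y (n + 1) ≃ₗ[R] EX R B Y (n + 1)) := by
  obtain ⟨δ, e1, e2⟩ := h.exists_pre Y n
  exact exact_bij e2 (h.pre_exact Y (n + 1)) h1 h2

lemma SES.pre_sub_mid (h : SES f g) (Y : Type) [AddCommGroup Y] [Module R Y] (n : ℕ)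
    (h1 : Subsingleton (EX R A Y n)) (h2 : Subsingleton (EX R C Y n)) :
    Subsingleton (EX R B Y n) := exact_sub (h.pre_exact Y n) h2 h1

lemma SES.pre_sub_left (h : SES f g) (Y : Type) [AddCommGroup Y] [Module R Y] (n : ℕ)
    (h1 : Subsingleton (EX R B Y n)) (h2 : Subsingleton (EX R C Y (n + 1))) :
    Subsingleton (EX R A Y n) := by
  obtain ⟨δ, e1, e2⟩ := h.exists_pre Y n
  exact exact_sub e1 h1 h2

lemma SES.pre_sub_right (h : SES f g) (Y : Type) [AddCommGroup Y] [Module R Y] (n : ℕ)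
    (h1 : Subsingleton (EX R A Y n)) (h2 : Subsingleton (EX R B Y (n + 1))) :
    Subsingleton (EX R C Y (n + 1)) := by
  obtain ⟨δ, e1, e2⟩ := h.exists_pre Y n
  exact exact_sub e2 h1 h2

lemma SES.post_sub_mid (h : SES f g) (X : Type) [AddCommGroup X] [Module R X] (n : ℕ)
    (h1 : Subsingleton (EX R X A n)) (h2 : Subsingleton (EX R X C n)) :
    Subsingleton (EX R X B n) := exact_sub (h.post_exact X n) h1 h2

lemma SES.post_sub_right (h : SES f g) (X : Type) [AddCommGroup X] [Module R X] (n : ℕ)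
    (h1 : Subsingleton (EX R X B n)) (h2 : Subsingleton (EX R X A (n + 1))) :
    Subsingleton (EX R X C n) := by
  obtain ⟨δ, e1, e2⟩ := h.exists_post X n
  exact exact_sub e1 h1 h2

lemma SES.post_sub_left (h : SES f g) (X : Type) [AddCommGroup X] [Module R X] (n : ℕ)
    (h1 : Subsingleton (EX R X C n)) (h2 : Subsingleton (EX R X B (n + 1))) :
    Subsingleton (EX R X A (n + 1)) := by
  obtain ⟨δ, e1, e2⟩ := h.exists_post X n
  exact exact_sub e2 h1 h2

/-- `Ext^1` as a cokernel, contravariant version. -/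
lemma SES.ext1_pre (h : SES f g) (Y : Type) [AddCommGroup Y] [Module R Y]
    (h1 : Subsingleton (EX R B Y 1)) :
    ∃ δ : (A →ₗ[R] Y) →ₗ[R] EX R C Y 1, Function.Surjective δ ∧
      ∀ φ, δ φ = 0 ↔ ∃ ψ : B →ₗ[R] Y, ψ ∘ₗ f = φ := by
  obtain ⟨δ, e1, e2⟩ := h.exists_pre Y 0
  refine ⟨δ ∘ₗ (homE A Y).toLinearMap, ?_, ?_⟩
  · intro y
    obtain ⟨x, hx⟩ := (e2 y).1 (Subsingleton.elim _ _)
    exact ⟨(homE A Y).symm x, by simpa using hx⟩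
  · intro φ
    refine (e1 _).trans ⟨?_, ?_⟩
    · rintro ⟨y, hy⟩
      refine ⟨(homE B Y).symm y, (homE A Y).injective ?_⟩
      rw [← pre_homE]; simpa using hy
    · rintro ⟨ψ, rfl⟩
      exact ⟨homE B Y ψ, pre_homE _ _⟩

/-- `Ext^1` as a cokernel, covariant version. -/
lemma SES.ext1_post (h : SES f g) (X : Type) [AddCommGroup X] [Module R X]
    (h1 : Subsingleton (EX R X B 1)) :
    ∃ δ : (X →ₗ[R] C) →ₗ[R] EX R X A 1, Function.Surjective δ ∧
      ∀ φ, δ φ = 0 ↔ ∃ ψ : X →ₗ[R] B, g ∘ₗ ψ = φ := by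
  obtain ⟨δ, e1, e2⟩ := h.exists_post X 0
  refine ⟨δ ∘ₗ (homE X C).toLinearMap, ?_, ?_⟩
  · intro y
    obtain ⟨x, hx⟩ := (e2 y).1 (Subsingleton.elim _ _)
    exact ⟨(homE X C).symm x, by simpa using hx⟩
  · intro φ
    refine (e1 _).trans ⟨?_, ?_⟩
    · rintro ⟨y, hy⟩
      refine ⟨(homE X B).symm y, (homE X C).injective ?_⟩
      rw [← post_homE]; simpa using hy
    · rintro ⟨ψ, rfl⟩
      exact ⟨homE X B ψ, post_homE _ _⟩

/-- extension of maps when `Ext^1` of the quotient vanishes -/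
lemma SES.extend (h : SES f g) (hC : Subsingleton (EX R C Y 1)) (φ : A →ₗ[R] Y) :
    ∃ ψ : B →ₗ[R] Y, ψ ∘ₗ f = φ := by
  obtain ⟨δ, e1, e2⟩ := h.exists_pre Y 0
  obtain ⟨y, hy⟩ := (e1 (homE A Y φ)).1 (Subsingleton.elim _ _)
  refine ⟨(homE B Y).symm y, (homE A Y).injective ?_⟩
  rw [← pre_homE]; simpa using hy

/-- lifting of maps when `Ext^1` to the kernel vanishes -/
lemma SES.lift (h : SES f g) (hC : Subsingleton (EX R X A 1)) (φ : X →ₗ[R] C) :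
    ∃ ψ : X →ₗ[R] B, g ∘ₗ ψ = φ := by
  obtain ⟨δ, e1, e2⟩ := h.exists_post X 0
  obtain ⟨y, hy⟩ := (e1 (homE X C φ)).1 (Subsingleton.elim _ _)
  refine ⟨(homE X B).symm y, (homE X C).injective ?_⟩
  rw [← post_homE]; simpa using hy

lemma ext_proj [Module.Projective R A] (n : ℕ) : Subsingleton (EX R A Y (n + 1)) :=
  Abelian.Ext.subsingleton_of_projective _ _ _

/-- `W` is a direct summand of a finite power of `Y`. -/
def Summ (R : Type) [CommRing R] (Y W : Type) [AddCommGroup Y] [Module R Y] [AddCommGroup W]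
    [Module R W] : Prop :=
  ∃ (r : ℕ) (a : Fin r → (W →ₗ[R] Y)) (b : Fin r → (Y →ₗ[R] W)), ∑ j, b j ∘ₗ a j = LinearMap.id

lemma Summ.ext_right (h : Summ R Y Z) (X : Type) [AddCommGroup X] [Module R X] (n : ℕ)
    (hX : Subsingleton (EX R X Y n)) : Subsingleton (EX R X Z n) := by
  obtain ⟨r, a, b, hab⟩ := h
  refine subsingleton_of_forall_eq 0 fun x => ?_
  rw [← post_id n x, ← hab, post_sum]
  refine Finset.sum_eq_zero fun j _ => ?_
  rw [← post_post, Subsingleton.elim (post X (a j) n x) 0, map_zero]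

lemma Summ.ext_left (h : Summ R Y Z) (X : Type) [AddCommGroup X] [Module R X] (n : ℕ)
    (hX : Subsingleton (EX R Y X n)) : Subsingleton (EX R Z X n) := by
  obtain ⟨r, a, b, hab⟩ := h
  refine subsingleton_of_forall_eq 0 fun x => ?_
  rw [← pre_id n x, ← hab, pre_sum]
  refine Finset.sum_eq_zero fun j _ => ?_
  rw [← pre_pre, Subsingleton.elim (pre (b j) X n x) 0, map_zero]

lemma summ_of_projective [Module.Finite R A] [Module.Projective R A] : Summ R R A := by
  obtain ⟨n, f, g, hf, hg, hfg⟩ := Module.Finite.exists_comp_eq_id_of_projective R A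
  refine ⟨n, fun j => LinearMap.proj j ∘ₗ g, fun j => f ∘ₗ LinearMap.single R (fun _ => R) j, ?_⟩
  rw [← hfg]
  ext x
  simp only [LinearMap.coe_sum, Finset.sum_apply, LinearMap.comp_apply, LinearMap.proj_apply]
  rw [← map_sum]
  congr 1
  exact Finset.univ_sum_single (g x)

open TensorProduct in
lemma Summ.tensor (h : Summ R R A) (Y : Type) [AddCommGroup Y] [Module R Y] :
    Summ R Y (A ⊗[R] Y) := by
  obtain ⟨r, a, b, hab⟩ := h
  refine ⟨r, fun j => (TensorProduct.lid R Y).toLinearMap ∘ₗ (a j).rTensor Y,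
    fun j => (b j).rTensor Y ∘ₗ (TensorProduct.lid R Y).symm.toLinearMap, ?_⟩
  apply TensorProduct.ext'
  intro x y
  have hx : ∑ j, b j (a j x) = x := by
    simpa using congrArg (fun f => f x) hab
  conv_rhs => rw [LinearMap.id_apply, ← hx, TensorProduct.sum_tmul]
  simp only [LinearMap.coe_sum, Finset.sum_apply]
  refine Finset.sum_congr rfl fun j _ => ?_
  simp only [LinearMap.comp_apply, LinearMap.rTensor_tmul, LinearEquiv.coe_coe,
    TensorProduct.lid_tmul, TensorProduct.lid_symm_apply]
  rw [← TensorProduct.smul_tmul, ← map_smul]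
  simp

lemma Summ.hom (h : Summ R R A) (Y : Type) [AddCommGroup Y] [Module R Y] :
    Summ R Y (A →ₗ[R] Y) := by
  obtain ⟨r, a, b, hab⟩ := h
  refine ⟨r, fun j => LinearMap.applyₗ (b j 1),
    fun j => LinearMap.flip (LinearMap.lsmul R Y ∘ₗ (a j)), ?_⟩
  ext φ x
  have hx : ∑ j, b j (a j x) = x := by
    simpa using congrArg (fun f => f x) hab
  conv_rhs => rw [LinearMap.id_apply, ← hx, map_sum]
  simp only [LinearMap.coe_sum, Finset.sum_apply]
  refine Finset.sum_congr rfl fun j _ => ?_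
  simp [← map_smul]

end extTools

end ARD

namespace ARD

section partB

variable {R : Type} [CommRing R]
variable {A B C X Y Z : Type} [AddCommGroup A] [Module R A] [AddCommGroup B] [Module R B]
    [AddCommGroup C] [Module R C] [AddCommGroup X] [Module R X] [AddCommGroup Y] [Module R Y]
    [AddCommGroup Z] [Module R Z]

/-- Cokernel of a linear map. -/
abbrev cok (u : A →ₗ[R] B) : Type := B ⧸ LinearMap.range u

/-- The map induced on a cokernel. -/
def cokMap (u : A →ₗ[R] B) (v : B →ₗ[R] C) (h : Function.Exact u v) : cok u →ₗ[R] C :=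
  (LinearMap.range u).liftQ v (by rintro _ ⟨x, rfl⟩; exact h.apply_apply_eq_zero x)

lemma cokMap_mk (u : A →ₗ[R] B) (v : B →ₗ[R] C) (h : Function.Exact u v) (b : B) :
    cokMap u v h ((LinearMap.range u).mkQ b) = v b := rfl

lemma ses_cok {u : A →ₗ[R] B} {v : B →ₗ[R] C} (h : Function.Exact u v) :
    SES (cokMap u v h) (LinearMap.range v).mkQ := by
  refine ⟨?_, ?_, Submodule.mkQ_surjective _⟩
  · rw [injective_iff_map_eq_zero]
    intro x hx
    obtain ⟨b, rfl⟩ := Submodule.mkQ_surjective _ x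
    rw [cokMap_mk] at hx
    obtain ⟨a, rfl⟩ := (h b).1 hx
    simp
  · intro c
    rw [Submodule.mkQ_apply, Submodule.Quotient.mk_eq_zero]
    constructor
    · rintro ⟨b, rfl⟩
      exact ⟨(LinearMap.range u).mkQ b, rfl⟩
    · rintro ⟨x, rfl⟩
      obtain ⟨b, rfl⟩ := Submodule.mkQ_surjective _ x
      exact ⟨b, rfl⟩

/-- Homology in the middle. -/
abbrev Hmid (f : A →ₗ[R] B) (g : B →ₗ[R] C) : Type :=
  (LinearMap.ker g) ⧸ (LinearMap.range f).comap (LinearMap.ker g).subtype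

lemma hmid_equiv (f : A →ₗ[R] B) (g : B →ₗ[R] C) (σ : LinearMap.ker g →ₗ[R] X)
    (hs : Function.Surjective σ) (hk : ∀ x, σ x = 0 ↔ ∃ a, f a = x.1) :
    Nonempty (Hmid f g ≃ₗ[R] X) := by
  have : (LinearMap.range f).comap (LinearMap.ker g).subtype = LinearMap.ker σ := by
    ext x
    rw [LinearMap.mem_ker, hk]
    rfl
  exact ⟨(Submodule.quotEquivOfEq _ _ this).trans (σ.quotKerEquivOfSurjective hs)⟩

/-- precomposition -/
abbrev preH (u : A →ₗ[R] B) (Y : Type) [AddCommGroup Y] [Module R Y] :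
    (B →ₗ[R] Y) →ₗ[R] (A →ₗ[R] Y) := LinearMap.lcomp R Y u

/-- postcomposition -/
abbrev postH (X : Type) [AddCommGroup X] [Module R X] (u : A →ₗ[R] B) :
    (X →ₗ[R] A) →ₗ[R] (X →ₗ[R] B) := LinearMap.llcomp R X A B u

lemma hmid_pre {u : A →ₗ[R] B} {v : B →ₗ[R] C} (h : Function.Exact u v)
    (Y : Type) [AddCommGroup Y] [Module R Y] (hC : Subsingleton (EX R C Y 1)) :
    Nonempty (Hmid (preH v Y) (preH u Y) ≃ₗ[R] EX R (cok v) Y 1) := by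
  obtain ⟨δ, hδ, hδ0⟩ := (ses_cok h).ext1_pre Y hC
  let θ : LinearMap.ker (preH u Y) →ₗ[R] (cok u →ₗ[R] Y) :=
    { toFun := fun φ => (LinearMap.range u).liftQ φ.1 (by
        rintro _ ⟨x, rfl⟩
        exact LinearMap.congr_fun (LinearMap.mem_ker.1 φ.2) x)
      map_add' := by intro x y; ext; rfl
      map_smul' := by intro x y; ext; rfl }
  have hθ : ∀ φ b, θ φ ((LinearMap.range u).mkQ b) = φ.1 b := fun φ b => rfl
  refine hmid_equiv _ _ (δ ∘ₗ θ) (hδ.comp ?_) ?_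
  · intro ψ
    refine ⟨⟨ψ ∘ₗ (LinearMap.range u).mkQ, ?_⟩, ?_⟩
    · rw [LinearMap.mem_ker]
      ext x
      change ψ ((LinearMap.range u).mkQ (u x)) = 0
      rw [show (LinearMap.range u).mkQ (u x) = 0 by simp, map_zero]
    · ext x; rfl
  · intro φ
    refine (hδ0 (θ φ)).trans (exists_congr fun ψ => ?_)
    constructor
    · intro h1
      ext b
      have := LinearMap.congr_fun h1 ((LinearMap.range u).mkQ b)
      rw [hθ] at this
      rw [← this]; rfl
    · intro h1
      ext b
      exact LinearMap.congr_fun h1 b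

lemma hmid_post {K I : Type} [AddCommGroup K] [Module R K] [AddCommGroup I] [Module R I]
    {k : K →ₗ[R] A} {p : A →ₗ[R] I} (hs : SES k p) {j : I →ₗ[R] B} (hj : Function.Injective j)
    {f : A →ₗ[R] B} {g : B →ₗ[R] C} (hf : f = j ∘ₗ p) (h : Function.Exact f g)
    (X : Type) [AddCommGroup X] [Module R X] (hC : Subsingleton (EX R X A 1)) :
    Nonempty (Hmid (postH X f) (postH X g) ≃ₗ[R] EX R X K 1) := by
  obtain ⟨δ, hδ, hδ0⟩ := hs.ext1_post X hC
  have hr : ∀ φ : LinearMap.ker (postH X g), ∀ x, φ.1 x ∈ LinearMap.range j := by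
    intro φ x
    have : g (φ.1 x) = 0 := LinearMap.congr_fun (LinearMap.mem_ker.1 φ.2) x
    obtain ⟨a, ha⟩ := (h _).1 this
    exact ⟨p a, by rw [← ha, hf]; rfl⟩
  let e := LinearEquiv.ofInjective j hj
  let θ : LinearMap.ker (postH X g) →ₗ[R] (X →ₗ[R] I) :=
    { toFun := fun φ => e.symm.toLinearMap ∘ₗ φ.1.codRestrict _ (hr φ)
      map_add' := by
        intro x y; ext z
        change e.symm _ = e.symm _ + e.symm _
        rw [← map_add]; rfl
      map_smul' := by
        intro x y; ext z
        change e.symm _ = x • e.symm _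
        rw [← map_smul]; rfl }
  have hθ : ∀ φ x, j (θ φ x) = φ.1 x := by
    intro φ x
    exact congrArg Subtype.val (e.apply_symm_apply (⟨φ.1 x, hr φ x⟩ : LinearMap.range j))
  refine hmid_equiv _ _ (δ ∘ₗ θ) (hδ.comp ?_) ?_
  · intro ψ
    refine ⟨⟨j ∘ₗ ψ, ?_⟩, ?_⟩
    · rw [LinearMap.mem_ker]
      ext x
      obtain ⟨a, ha⟩ := hs.surj (ψ x)
      change g (j (ψ x)) = 0
      rw [← ha]
      have := h.apply_apply_eq_zero a
      rwa [hf] at this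
    · ext x
      exact hj (hθ _ _)
  · intro φ
    refine (hδ0 (θ φ)).trans (exists_congr fun ψ => ?_)
    constructor
    · intro h1
      ext b
      rw [← hθ φ b, ← h1, hf]; rfl
    · intro h1
      ext b
      apply hj
      rw [hθ, ← h1, hf]; rfl

/-- congruence for middle homology -/
lemma hmid_congr {A' B' C' : Type} [AddCommGroup A'] [Module R A'] [AddCommGroup B'] [Module R B']
    [AddCommGroup C'] [Module R C'] {f : A →ₗ[R] B} {g : B →ₗ[R] C} {f' : A' →ₗ[R] B'}
    {g' : B' →ₗ[R] C'} (a : A ≃ₗ[R] A') (b : B ≃ₗ[R] B') (c : C ≃ₗ[R] C')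
    (h1 : ∀ x, b (f x) = f' (a x)) (h2 : ∀ x, c (g x) = g' (b x)) :
    Nonempty (Hmid f g ≃ₗ[R] Hmid f' g') := by
  let θ : LinearMap.ker g →ₗ[R] LinearMap.ker g' :=
    (b.toLinearMap ∘ₗ (LinearMap.ker g).subtype).codRestrict _ (by
      intro x
      rw [LinearMap.mem_ker]
      change g' (b x.1) = 0
      rw [← h2, LinearMap.mem_ker.1 x.2, map_zero])
  have hθ : ∀ x, (θ x).1 = b x.1 := fun _ => rfl
  refine hmid_equiv _ _ (Submodule.mkQ _ ∘ₗ θ) ((Submodule.mkQ_surjective _).comp ?_) ?_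
  · intro y
    refine ⟨⟨b.symm y.1, ?_⟩, Subtype.ext (b.apply_symm_apply _)⟩
    rw [LinearMap.mem_ker]
    apply c.injective
    rw [h2, b.apply_symm_apply, map_zero]
    exact y.2
  · intro x
    rw [LinearMap.comp_apply, Submodule.mkQ_apply, Submodule.Quotient.mk_eq_zero]
    change (θ x).1 ∈ LinearMap.range f' ↔ _
    rw [hθ]
    constructor
    · rintro ⟨y, hy⟩
      refine ⟨a.symm y, b.injective ?_⟩
      rw [h1, a.apply_symm_apply, hy]
    · rintro ⟨y, hy⟩
      exact ⟨a y, by rw [← h1, hy]⟩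

/-- finite injective dimension, in terms of Ext -/
def FinInj (R : Type) [CommRing R] (Y : Type) [AddCommGroup Y] [Module R Y] : Prop :=
  ∃ s : ℕ, ∀ (X : ModuleCat.{0} R) (n : ℕ), s < n → Subsingleton (EX R X Y n)

/-- dimension shifting, descending families -/
lemma shift_down (hY : FinInj R Y) (A B : ℤ → ModuleCat.{0} R)
    (f : ∀ i, A (i + 1) →ₗ[R] B i) (g : ∀ i, B i →ₗ[R] A i) (h : ∀ i, SES (f i) (g i))
    (m : ℕ) (hB : ∀ i n, m ≤ n → Subsingleton (EX R (B i) Y (n + 1))) (i : ℤ) (n : ℕ)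
    (hn : m ≤ n) :
    Subsingleton (EX R (A i) Y (n + 1)) := by
  obtain ⟨s, hs⟩ := hY
  have key : ∀ k n : ℕ, m ≤ n → s < n + k → ∀ i, Subsingleton (EX R (A i) Y (n + 1)) := by
    intro k
    induction k with
    | zero => intro n _ hn i; exact hs (A i) _ (by omega)
    | succ k ih =>
      intro n hm hn i
      obtain ⟨i, rfl⟩ : ∃ i', i = i' + 1 := ⟨i - 1, by ring⟩
      exact (h i).pre_sub_left Y (n + 1) (hB i n hm) (ih (n + 1) (by omega) (by omega) i)
  exact key (s + 1) n hn (by omega) i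

/-- dimension shifting, ascending families -/
lemma shift_up (hY : FinInj R Y) (A B : ℤ → ModuleCat.{0} R)
    (f : ∀ i, A i →ₗ[R] B i) (g : ∀ i, B i →ₗ[R] A (i + 1)) (h : ∀ i, SES (f i) (g i))
    (m : ℕ) (hB : ∀ i n, m ≤ n → Subsingleton (EX R (B i) Y (n + 1))) (i : ℤ) (n : ℕ)
    (hn : m ≤ n) :
    Subsingleton (EX R (A i) Y (n + 1)) := by
  obtain ⟨s, hs⟩ := hY
  have key : ∀ k n : ℕ, m ≤ n → s < n + k → ∀ i, Subsingleton (EX R (A i) Y (n + 1)) := by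
    intro k
    induction k with
    | zero => intro n _ hn i; exact hs (A i) _ (by omega)
    | succ k ih =>
      intro n hm hn i
      exact (h i).pre_sub_left Y (n + 1) (hB i n hm) (ih (n + 1) (by omega) (by omega) (i + 1))
  exact key (s + 1) n hn (by omega) i

/-- A totally acyclic complex of finite projective modules. -/
structure TA (R : Type) [CommRing R] where
  T : ℤ → ModuleCat.{0} R
  t : ∀ i, T (i + 1) →ₗ[R] T i
  proj : ∀ i, Module.Projective R (T i)
  fin : ∀ i, Module.Finite R (T i)
  ex : ∀ i, Function.Exact (t (i + 1)) (t i)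
  exd : ∀ i, Function.Exact (preH (t i) R) (preH (t (i + 1)) R)

attribute [instance] TA.proj TA.fin

namespace TA

variable (K : TA R)

/-- the cosyzygy modules -/
abbrev Q (i : ℤ) : Type := cok (K.t i)

/-- inclusion -/
abbrev inc (i : ℤ) : K.Q (i + 1) →ₗ[R] K.T i := cokMap _ _ (K.ex i)

lemma ses (i : ℤ) : SES (K.inc i) (LinearMap.range (K.t i)).mkQ := ses_cok (K.ex i)

lemma summ (i : ℤ) : Summ R R (K.T i) := summ_of_projective

lemma ext_T (i : ℤ) (n : ℕ) : Subsingleton (EX R (K.T i) Y (n + 1)) := ext_proj (A := K.T i) n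

lemma shift (i : ℤ) (n : ℕ) (Y : Type) [AddCommGroup Y] [Module R Y] :
    Nonempty (EX R (K.Q (i + 1)) Y (n + 1) ≃ₗ[R] EX R (K.Q i) Y (n + 2)) :=
  (K.ses i).shift_pre Y (n + 1) (K.ext_T i n) (K.ext_T i (n + 1))

lemma ext_inj (hY : FinInj R Y) (i : ℤ) (n : ℕ) : Subsingleton (EX R (K.Q i) Y (n + 1)) :=
  shift_down hY (fun i => ModuleCat.of R (K.Q i)) K.T K.inc
    (fun i => (LinearMap.range (K.t i)).mkQ) K.ses 0 (fun i n _ => K.ext_T i n) i n (Nat.zero_le _)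

lemma ext_R (i : ℤ) (n : ℕ) : Subsingleton (EX R (K.Q i) R (n + 1)) := by
  induction n generalizing i with
  | zero =>
    obtain ⟨δ, h1, h2⟩ := (K.ses i).ext1_pre R (K.ext_T i 0)
    refine subsingleton_of_forall_eq 0 fun x => ?_
    obtain ⟨φ, rfl⟩ := h1 x
    rw [h2]
    have : preH (K.t (i + 1)) R (φ ∘ₗ (LinearMap.range (K.t (i + 1))).mkQ) = 0 := by
      ext x
      change φ ((LinearMap.range (K.t (i + 1))).mkQ (K.t (i + 1) x)) = 0
      rw [show (LinearMap.range (K.t (i + 1))).mkQ (K.t (i + 1) x) = 0 by simp, map_zero]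
    obtain ⟨ψ, hψ⟩ := (K.exd i _).1 this
    refine ⟨ψ, ?_⟩
    ext x
    exact LinearMap.congr_fun hψ x
  | succ n ih =>
    obtain ⟨e⟩ := K.shift i n R
    have := ih (i + 1)
    exact e.symm.injective.subsingleton

lemma ext_P [Module.Finite R Y] [Module.Projective R Y] (i : ℤ) (n : ℕ) :
    Subsingleton (EX R (K.Q i) Y (n + 1)) :=
  (summ_of_projective (R := R) (A := Y)).ext_right _ _ (K.ext_R i n)

end TA

/-- evaluation `A ⊗ Y → Hom(A^*, Y)` -/
def evm (A Y : Type) [AddCommGroup A] [Module R A] [AddCommGroup Y] [Module R Y] :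
    TensorProduct R A Y →ₗ[R] ((A →ₗ[R] R) →ₗ[R] Y) :=
  TensorProduct.lift (LinearMap.mk₂ R
    (fun a y => (LinearMap.toSpanSingleton R Y y) ∘ₗ (LinearMap.applyₗ a))
    (by intro a b y; ext φ; simp [add_smul]) (by intro c a y; ext φ; simp [mul_smul])
    (by intro a y z; ext φ; simp) (by intro c a y; ext φ; simp [smul_comm c]))

lemma evm_tmul (a : A) (y : Y) (φ : A →ₗ[R] R) :
    evm A Y (TensorProduct.tmul R a y) φ = φ a • y := rfl

lemma evm_nat (u : A →ₗ[R] B) (x : TensorProduct R A Y) :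
    evm B Y (u.rTensor Y x) = preH (preH u R) Y (evm A Y x) := by
  induction x with
  | zero => simp
  | add x y hx hy => rw [map_add, map_add, map_add, hx, hy, map_add]
  | tmul a y => ext φ; rfl

lemma evm_bij (h : Summ R R A) : Function.Bijective (evm (R := R) A Y) := by
  obtain ⟨r, a, b, hab⟩ := h
  have hx : ∀ x, ∑ j, b j (a j x) = x := fun x => by
    simpa using congrArg (fun f => f x) hab
  have hb : ∀ j (c : R), b j c = c • b j 1 := fun j c => by rw [← map_smul]; simp
  refine Function.bijective_iff_has_inverse.2
    ⟨fun h => ∑ j, TensorProduct.tmul R (b j 1) (h (a j)), ?_, ?_⟩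
  · intro z
    induction z with
    | zero => simp
    | add x y hx hy =>
      conv_rhs => rw [← hx, ← hy]
      simp only [map_add, LinearMap.add_apply, TensorProduct.tmul_add, Finset.sum_add_distrib]
    | tmul x y =>
      simp only [evm_tmul]
      conv_rhs => rw [← hx x, TensorProduct.sum_tmul]
      refine Finset.sum_congr rfl fun j _ => ?_
      rw [hb j (a j x), TensorProduct.smul_tmul]
  · intro h
    ext φ
    simp only [map_sum, LinearMap.coe_sum, Finset.sum_apply, evm_tmul]
    simp only [← map_smul]
    rw [← map_sum]
    congr 1
    ext x
    conv_rhs => rw [← hx x, map_sum]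
    simp only [LinearMap.coe_sum, Finset.sum_apply, LinearMap.smul_apply, smul_eq_mul]
    refine Finset.sum_congr rfl fun j _ => ?_
    rw [hb j (a j x), map_smul, smul_eq_mul, mul_comm]

namespace TA

variable (K : TA R)

lemma ext_V (hY : FinInj R Y) (i : ℤ) (n : ℕ) :
    Subsingleton (EX R (cok (preH (K.t i) R)) Y (n + 1)) :=
  shift_up hY (fun i => ModuleCat.of R (cok (preH (K.t i) R)))
    (fun i => ModuleCat.of R (K.T (i + 1 + 1) →ₗ[R] R))
    (fun i => cokMap _ _ (K.exd i)) (fun i => (LinearMap.range (preH (K.t (i + 1)) R)).mkQ)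
    (fun i => ses_cok (K.exd i)) 0
    (fun i n _ => by
      have : Subsingleton (EX R R Y (n + 1)) := ext_proj n
      exact ((K.summ (i + 1 + 1)).hom R).ext_left Y (n + 1) this) i n (Nat.zero_le _)

lemma tensor_exact (hY : FinInj R Y) (i : ℤ) :
    Function.Exact ((K.t (i + 1)).rTensor Y) ((K.t i).rTensor Y) := by
  intro x
  constructor
  · intro hx
    have h1 : preH (preH (K.t i) R) Y (evm (K.T (i + 1)) Y x) = 0 := by
      rw [← evm_nat, hx, map_zero]
    let φ : cok (preH (K.t i) R) →ₗ[R] Y := Submodule.liftQ _ (evm (K.T (i + 1)) Y x) (by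
      rintro _ ⟨z, rfl⟩
      exact LinearMap.congr_fun h1 z)
    obtain ⟨ψ, hψ⟩ := (ses_cok (K.exd i)).extend (K.ext_V hY (i + 1) 0) φ
    obtain ⟨y, hy⟩ := (evm_bij (Y := Y) (K.summ (i + 1 + 1))).2 ψ
    refine ⟨y, (evm_bij (Y := Y) (K.summ (i + 1))).1 ?_⟩
    rw [evm_nat, hy]
    ext z
    exact LinearMap.congr_fun hψ (Submodule.mkQ _ z)
  · rintro ⟨y, rfl⟩
    rw [← LinearMap.rTensor_comp_apply]
    rw [show K.t i ∘ₗ K.t (i + 1) = 0 from by ext z; exact (K.ex i).apply_apply_eq_zero z]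
    simp

lemma ses_tensor (hY : FinInj R Y) (i : ℤ) :
    SES ((K.inc i).rTensor Y) ((LinearMap.range (K.t i)).mkQ.rTensor Y) := by
  refine ⟨?_, rTensor_exact Y (K.ses i).ex (K.ses i).surj,
    LinearMap.rTensor_surjective Y (K.ses i).surj⟩
  rw [injective_iff_map_eq_zero]
  intro x hx
  obtain ⟨y, rfl⟩ := LinearMap.rTensor_surjective Y
    (Submodule.mkQ_surjective (LinearMap.range (K.t (i + 1)))) x
  rw [← LinearMap.rTensor_comp_apply] at hx
  obtain ⟨z, rfl⟩ := (K.tensor_exact hY i y).1 hx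
  rw [← LinearMap.rTensor_comp_apply]
  rw [show (LinearMap.range (K.t (i + 1))).mkQ ∘ₗ K.t (i + 1) = 0 from by ext z; simp]
  simp

end TA

end partB

end ARD

namespace ARD

section partG

variable {R : Type} [CommRing R]
variable {A B C X Y Z : Type} [AddCommGroup A] [Module R A] [AddCommGroup B] [Module R B]
    [AddCommGroup C] [Module R C] [AddCommGroup X] [Module R X] [AddCommGroup Y] [Module R Y]
    [AddCommGroup Z] [Module R Z]

variable (ω : Type) [AddCommGroup ω] [Module R ω]

/-- in the Auslander class (half) -/
def Good (X : Type) [AddCommGroup X] [Module R X] : Prop :=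
  (∀ n, Subsingleton (EX R ω (TensorProduct R X ω) (n + 1))) ∧
    Function.Bijective (TensorProduct.mk R X ω)

variable {ω}

lemma mk_nat (u : A →ₗ[R] B) (x : A) :
    TensorProduct.mk R B ω (u x) = u.rTensor ω ∘ₗ TensorProduct.mk R A ω x := by
  ext w; simp

lemma homothety_bij (e : (ω →ₗ[R] ω) ≃ₗ[R] R) :
    (∀ r : R, r • (LinearMap.id : ω →ₗ[R] ω) = 0 → r = 0) ∧
    (∀ g : ω →ₗ[R] ω, ∃ r : R, g = r • LinearMap.id) := by
  constructor
  · intro r hr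
    have h1 : r • e.symm 1 = 0 := by
      have : r • e.symm 1 = (r • LinearMap.id) ∘ₗ e.symm 1 := by ext; simp
      rw [this, hr, LinearMap.zero_comp]
    have := congrArg e h1
    simpa using this
  · have hg : ∀ g : ω →ₗ[R] ω, g = e g • e.symm 1 := fun g => by
      apply e.injective; simp
    set f := e.symm 1
    have hinj : ∀ x, f x = 0 → x = 0 := by
      intro x hx
      have := LinearMap.congr_fun (hg LinearMap.id) x
      simpa [hx] using this
    have hs : ∃ s : R, f = s • LinearMap.id := by
      refine ⟨e (f ∘ₗ f), ?_⟩
      ext x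
      have h1 := LinearMap.congr_fun (hg (f ∘ₗ f)) x
      have : f (f x - e (f ∘ₗ f) • x) = 0 := by
        rw [map_sub, map_smul]
        exact sub_eq_zero.2 h1
      simpa using sub_eq_zero.1 (hinj _ this)
    obtain ⟨s, hs⟩ := hs
    intro g
    refine ⟨e g * s, ?_⟩
    conv_lhs => rw [hg g, hs]
    rw [smul_smul]

lemma good_R (e : (ω →ₗ[R] ω) ≃ₗ[R] R) (h : ∀ n, Subsingleton (EX R ω ω (n + 1))) :
    Good (R := R) ω R := by
  obtain ⟨h1, h2⟩ := homothety_bij e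
  refine ⟨fun n => ?_, ?_, ?_⟩
  · have := h n
    exact (postEquiv ω (TensorProduct.lid R ω) (n + 1)).injective.subsingleton
  · rw [injective_iff_map_eq_zero]
    intro r hr
    apply h1
    ext w
    have := congrArg (TensorProduct.lid R ω) (LinearMap.congr_fun hr w)
    simpa using this
  · intro g
    obtain ⟨r, hr⟩ := h2 ((TensorProduct.lid R ω).toLinearMap ∘ₗ g)
    refine ⟨r, ?_⟩
    ext w
    apply (TensorProduct.lid R ω).injective
    have := LinearMap.congr_fun hr w
    simpa using this.symm

lemma good_summ (hR : Good (R := R) ω R) (h : Summ R R A) : Good (R := R) ω A := by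
  refine ⟨fun n => ?_, ?_⟩
  · have h1 : Summ R ω (TensorProduct R A ω) := h.tensor ω
    refine h1.ext_right _ _ ?_
    have := hR.1 n
    exact (postEquiv ω (TensorProduct.lid R ω) (n + 1)).symm.injective.subsingleton
  · obtain ⟨r, a, b, hab⟩ := h
    have hx : ∀ x, ∑ j, b j (a j x) = x := fun x => by
      simpa using congrArg (fun f => f x) hab
    constructor
    · rw [injective_iff_map_eq_zero]
      intro x hx0
      rw [← hx x]
      refine Finset.sum_eq_zero fun j _ => ?_
      have : a j x = 0 := by
        apply hR.2.1
        rw [mk_nat, hx0, LinearMap.comp_zero, map_zero]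
      rw [this, map_zero]
    · intro g
      choose c hc using fun j => hR.2.2 ((a j).rTensor ω ∘ₗ g)
      refine ⟨∑ j, b j (c j), ?_⟩
      rw [map_sum]
      simp only [mk_nat, hc]
      ext w
      have : ∀ z : TensorProduct R A ω, ∑ j, (b j).rTensor ω ((a j).rTensor ω z) = z := by
        intro z
        simp only [← LinearMap.rTensor_comp_apply]
        have := congrArg (fun f => LinearMap.rTensor ω f z) hab
        simp only [LinearMap.rTensor_id, LinearMap.id_apply] at this
        conv_rhs => rw [← this]
        rw [← LinearMap.coe_rTensorHom, map_sum]
        simp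
      simpa using this (g w)

lemma good_equiv (e : A ≃ₗ[R] B) (h : Good (R := R) ω A) : Good (R := R) ω B := by
  have he : ∀ z : TensorProduct R B ω,
      e.toLinearMap.rTensor ω (e.symm.toLinearMap.rTensor ω z) = z := fun z => by
    rw [← LinearMap.rTensor_comp_apply]; simp
  have he' : ∀ z : TensorProduct R A ω,
      e.symm.toLinearMap.rTensor ω (e.toLinearMap.rTensor ω z) = z := fun z => by
    rw [← LinearMap.rTensor_comp_apply]; simp
  refine ⟨fun n => ?_, ?_, ?_⟩
  · have := h.1 n
    exact (postEquiv ω (TensorProduct.congr e (LinearEquiv.refl R ω))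
      (n + 1)).symm.injective.subsingleton
  · rw [injective_iff_map_eq_zero]
    intro x hx
    apply e.symm.injective
    rw [map_zero]
    apply h.2.1
    have := mk_nat (ω := ω) e.symm.toLinearMap x
    rw [hx, LinearMap.comp_zero] at this
    simpa using this
  · intro g
    obtain ⟨a, ha⟩ := h.2.2 (e.symm.toLinearMap.rTensor ω ∘ₗ g)
    refine ⟨e a, ?_⟩
    have := mk_nat (ω := ω) e.toLinearMap a
    rw [ha] at this
    refine this.trans ?_
    ext w
    exact he _

namespace TA

variable (K : TA R)

lemma good_T (hR : Good (R := R) ω R) (i : ℤ) : Good (R := R) ω (K.T i) :=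
  good_summ hR (K.summ i)

lemma good_Q (hω : FinInj R ω) (hR : Good (R := R) ω R) (i : ℤ) : Good (R := R) ω (K.Q i) := by
  have hinj : ∀ i, Function.Injective (TensorProduct.mk R (K.Q i) ω) := by
    intro i
    obtain ⟨i, rfl⟩ : ∃ i', i = i' + 1 := ⟨i - 1, by ring⟩
    rw [injective_iff_map_eq_zero]
    intro x hx
    apply (K.ses i).inj
    rw [map_zero]
    apply (K.good_T hR i).2.1
    rw [mk_nat, hx, LinearMap.comp_zero, map_zero]
  have hsurj : ∀ i, Function.Surjective (TensorProduct.mk R (K.Q i) ω) := by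
    intro i
    obtain ⟨i, rfl⟩ : ∃ i', i = i' + 1 := ⟨i - 1, by ring⟩
    intro g
    obtain ⟨y, hy⟩ := (K.good_T hR i).2.2 ((K.inc i).rTensor ω ∘ₗ g)
    have h0 : (LinearMap.range (K.t i)).mkQ y = 0 := by
      apply hinj
      rw [mk_nat, hy, map_zero]
      ext w
      exact (K.ses_tensor hω i).ex.apply_apply_eq_zero _
    obtain ⟨x, rfl⟩ := ((K.ses i).ex y).1 h0
    refine ⟨x, ?_⟩
    rw [mk_nat] at hy
    ext w
    exact (K.ses_tensor hω i).inj (LinearMap.congr_fun hy w)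
  refine ⟨fun n => ?_, hinj i, hsurj i⟩
  induction n generalizing i with
  | zero =>
    obtain ⟨i, rfl⟩ : ∃ i', i = i' + 1 := ⟨i - 1, by ring⟩
    obtain ⟨δ, h1, h2⟩ := (K.ses_tensor hω i).ext1_post ω ((K.good_T hR i).1 0)
    refine subsingleton_of_forall_eq 0 fun x => ?_
    obtain ⟨φ, rfl⟩ := h1 x
    rw [h2]
    obtain ⟨q, rfl⟩ := hsurj i φ
    obtain ⟨y, rfl⟩ := (K.ses i).surj q
    exact ⟨_, (mk_nat _ y).symm⟩
  | succ n ih =>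
    obtain ⟨i, rfl⟩ : ∃ i', i = i' + 1 := ⟨i - 1, by ring⟩
    exact (K.ses_tensor hω i).post_sub_left ω (n + 1) (ih i) ((K.good_T hR i).1 (n + 1))

end TA

lemma good_descend [IsNoetherianRing R] [Module.Finite R ω]
    (hann : ∀ r : R, r • (LinearMap.id : ω →ₗ[R] ω) = 0 → r = 0)
    {f : A →ₗ[R] B} {g : B →ₗ[R] C} (h : SES f g) [Module.Finite R A] (hA : Good (R := R) ω A)
    (hB : Good (R := R) ω B) :
    SES (f.rTensor ω) (g.rTensor ω) ∧ Good (R := R) ω C := by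
  have hs : SES (f.rTensor ω) (g.rTensor ω) := by
    refine ⟨?_, rTensor_exact ω h.ex h.surj, LinearMap.rTensor_surjective ω h.surj⟩
    rw [← LinearMap.ker_eq_bot]
    have hsub : Subsingleton (ω →ₗ[R] LinearMap.ker (f.rTensor ω)) := by
      refine subsingleton_of_forall_eq 0 fun φ => ?_
      obtain ⟨u, hu⟩ := hA.2.2 ((LinearMap.ker (f.rTensor ω)).subtype ∘ₗ φ)
      have h0 : u = 0 := by
        apply h.inj
        rw [map_zero]
        apply hB.2.1
        rw [mk_nat, hu, map_zero]
        ext w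
        exact (φ w).2
      rw [h0, map_zero] at hu
      ext w
      exact (LinearMap.congr_fun hu w).symm
    obtain ⟨r, hr, hreg⟩ := IsSMulRegular.subsingleton_linearMap_iff.1 hsub
    have : r = 0 := hann r (by ext w; exact Module.mem_annihilator.1 hr w)
    subst this
    rw [Submodule.eq_bot_iff]
    intro x hx
    have := @hreg ⟨x, hx⟩ 0 (by simp)
    simpa using this
  refine ⟨hs, fun n => hs.post_sub_right ω (n + 1) (hB.1 n) (hA.1 (n + 1)), ?_, ?_⟩
  · rw [injective_iff_map_eq_zero]
    intro c hc
    obtain ⟨p, rfl⟩ := h.surj c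
    rw [mk_nat] at hc
    have hr : ∀ w, TensorProduct.mk R B ω p w ∈ LinearMap.range (f.rTensor ω) := fun w =>
      (hs.ex _).1 (LinearMap.congr_fun hc w)
    let e := LinearEquiv.ofInjective (f.rTensor ω) hs.inj
    obtain ⟨u, hu⟩ := hA.2.2 (e.symm.toLinearMap ∘ₗ (TensorProduct.mk R B ω p).codRestrict _ hr)
    have : p = f u := by
      apply hB.2.1
      rw [mk_nat, hu]
      ext w
      exact (congrArg Subtype.val (e.apply_symm_apply
        (⟨TensorProduct.mk R B ω p w, hr w⟩ : LinearMap.range (f.rTensor ω)))).symm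
    rw [this, h.ex.apply_apply_eq_zero]
  · intro φ
    obtain ⟨ψ, hψ⟩ := hs.lift (hA.1 0) φ
    obtain ⟨p, hp⟩ := hB.2.2 ψ
    exact ⟨g p, by rw [mk_nat, hp, hψ]⟩

end partG

end ARD

namespace ARD

section partD

variable {R : Type} [CommRing R]
variable {A B C X Y Z : Type} [AddCommGroup A] [Module R A] [AddCommGroup B] [Module R B]
    [AddCommGroup C] [Module R C] [AddCommGroup X] [Module R X] [AddCommGroup Y] [Module R Y]
    [AddCommGroup Z] [Module R Z]

/-- A family of syzygies. -/
structure Syz (R : Type) [CommRing R] where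
  U : ℕ → ModuleCat.{0} R
  P : ℕ → ModuleCat.{0} R
  f : ∀ l, U (l + 1) →ₗ[R] P l
  g : ∀ l, P l →ₗ[R] U l
  ses : ∀ l, SES (f l) (g l)
  proj : ∀ l, Module.Projective R (P l)
  fin : ∀ l, Module.Finite R (P l)
  finU : ∀ l, Module.Finite R (U l)

attribute [instance] Syz.proj Syz.fin Syz.finU

lemma shift2 (K : TA R) {f : A →ₗ[R] B} {g : B →ₗ[R] C} (h : SES f g) (j : ℤ)
    (h1 : ∀ n, Subsingleton (EX R (K.Q j) B (n + 1))) :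
    Nonempty (EX R (K.Q j) C 1 ≃ₗ[R] EX R (K.Q (j + 1)) A 1) := by
  obtain ⟨e1⟩ := h.shift_post (K.Q j) 1 (h1 0) (h1 1)
  obtain ⟨e2⟩ := K.shift j 0 A
  exact ⟨e1.trans e2.symm⟩

lemma phi2 (K : TA R) (S : Syz R) (l : ℕ) : ∀ (j j' : ℤ), j' = j + l →
    Nonempty (EX R (K.Q j) (S.U 0) 1 ≃ₗ[R] EX R (K.Q j') (S.U l) 1) := by
  induction l with
  | zero => intro j j' h; obtain rfl : j' = j := by simpa using h
            exact ⟨LinearEquiv.refl _ _⟩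
  | succ l ih =>
    intro j j' h
    obtain ⟨e1⟩ := ih j (j + l) rfl
    obtain ⟨e2⟩ := shift2 K (S.ses l) (j + l) (fun n => K.ext_P (Y := S.P l) (j + l) n)
    obtain rfl : j' = j + l + 1 := by rw [h]; push_cast; ring
    exact ⟨e1.trans e2⟩

lemma ext_tensor (K : TA R) (hY : FinInj R Y) (h : Summ R R A) (j : ℤ) (n : ℕ) :
    Subsingleton (EX R (K.Q j) (TensorProduct R A Y) (n + 1)) :=
  (h.tensor Y).ext_right _ _ (K.ext_inj hY j n)

lemma phi4 (K K' : TA R) (hY : FinInj R Y) (a c a' c' : ℤ) (h : a - c = a' - c') :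
    Nonempty (EX R (K'.Q a) (TensorProduct R (K.Q c) Y) 1 ≃ₗ[R]
      EX R (K'.Q a') (TensorProduct R (K.Q c') Y) 1) := by
  have key : ∀ (n : ℕ) (a c a' c' : ℤ), a' = a + n → c' = c + n →
      Nonempty (EX R (K'.Q a) (TensorProduct R (K.Q c) Y) 1 ≃ₗ[R]
        EX R (K'.Q a') (TensorProduct R (K.Q c') Y) 1) := by
    intro n
    induction n with
    | zero =>
      intro a c a' c' h1 h2
      obtain rfl : a' = a := by simpa using h1
      obtain rfl : c' = c := by simpa using h2
      exact ⟨LinearEquiv.refl _ _⟩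
    | succ n ih =>
      intro a c a' c' h1 h2
      obtain ⟨e1⟩ := ih a c (a + n) (c + n) rfl rfl
      obtain ⟨e2⟩ := shift2 K' (K.ses_tensor hY (c + n)) (a + n)
        (fun m => ext_tensor K' hY (K.summ (c + n)) (a + n) m)
      obtain rfl : a' = a + n + 1 := by rw [h1]; push_cast; ring
      obtain rfl : c' = c + n + 1 := by rw [h2]; push_cast; ring
      exact ⟨e1.trans e2⟩
  rcases le_total a a' with h1 | h1
  · exact key (a' - a).toNat a c a' c' (by omega) (by omega)
  · obtain ⟨e⟩ := key (a - a').toNat a' c' a c (by omega) (by omega)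
    exact ⟨e.symm⟩

/-- tensor sequences of syzygies are exact -/
lemma syz_tensor [IsNoetherianRing R] {ω : Type} [AddCommGroup ω] [Module R ω] [Module.Finite R ω]
    (hω : FinInj R ω) (hR : Good (R := R) ω R)
    (hann : ∀ r : R, r • (LinearMap.id : ω →ₗ[R] ω) = 0 → r = 0)
    (K : TA R) (S : Syz R) (m : ℕ) (e : K.Q m ≃ₗ[R] S.U m) (l : ℕ) (hl : l < m) :
    SES ((S.f l).rTensor ω) ((S.g l).rTensor ω) := by
  have hP : ∀ l, Good (R := R) ω (S.P l) := fun l => good_summ hR summ_of_projective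
  have key : ∀ k l, l + k = m → Good (R := R) ω (S.U l) := by
    intro k
    induction k with
    | zero => rintro l rfl; exact good_equiv e (K.good_Q hω hR _)
    | succ k ih =>
      intro l hl
      exact (good_descend hann (S.ses l) (ih (l + 1) (by omega)) (hP l)).2
  exact (good_descend hann (S.ses l) (key (m - (l + 1)) (l + 1) (by omega)) (hP l)).1

lemma phi5 [IsNoetherianRing R] {ω : Type} [AddCommGroup ω] [Module R ω] [Module.Finite R ω]
    (hω : FinInj R ω) (hR : Good (R := R) ω R)
    (hann : ∀ r : R, r • (LinearMap.id : ω →ₗ[R] ω) = 0 → r = 0)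
    (K K' : TA R) (S : Syz R) (m : ℕ) (e : K.Q m ≃ₗ[R] S.U m) (j : ℤ) :
    Nonempty (EX R (K'.Q j) (TensorProduct R (S.U 0) ω) 1 ≃ₗ[R]
      EX R (K'.Q (j + m)) (TensorProduct R (K.Q m) ω) 1) := by
  have key : ∀ l : ℕ, l ≤ m → ∀ j' : ℤ, j' = j + l →
      Nonempty (EX R (K'.Q j) (TensorProduct R (S.U 0) ω) 1 ≃ₗ[R]
      EX R (K'.Q j') (TensorProduct R (S.U l) ω) 1) := by
    intro l
    induction l with
    | zero => intro _ j' h; obtain rfl : j' = j := by simpa using h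
              exact ⟨LinearEquiv.refl _ _⟩
    | succ l ih =>
      intro hl j' h
      obtain ⟨e1⟩ := ih (by omega) (j + l) rfl
      obtain ⟨e2⟩ := shift2 K' (syz_tensor hω hR hann K S m e l (by omega)) (j + l)
        (fun n => ext_tensor K' hω summ_of_projective (j + l) n)
      obtain rfl : j' = j + l + 1 := by rw [h]; push_cast; ring
      exact ⟨e1.trans e2⟩
  obtain ⟨e1⟩ := key m le_rfl _ rfl
  exact ⟨e1.trans (postEquiv _ (TensorProduct.congr e (LinearEquiv.refl R ω)) 1).symm⟩

/-! ### the duality spectral argument -/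

lemma ses_hmid {f : A →ₗ[R] B} {g : B →ₗ[R] C} (h : ∀ x, g (f x) = 0) :
    ∃ (p : Hmid f g →ₗ[R] cok f) (q : cok f →ₗ[R] LinearMap.range g), SES p q ∧
      (∀ x, p (Submodule.mkQ _ x) = (LinearMap.range f).mkQ x.1) ∧
      ∀ b, (q ((LinearMap.range f).mkQ b)).1 = g b := by
  let p : Hmid f g →ₗ[R] cok f := Submodule.mapQ _ _ (LinearMap.ker g).subtype le_rfl
  let q : cok f →ₗ[R] LinearMap.range g := (LinearMap.range f).liftQ g.rangeRestrict (by
    rintro _ ⟨x, rfl⟩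
    rw [LinearMap.mem_ker]
    exact Subtype.ext (h x))
  have hp : ∀ x, p (Submodule.mkQ _ x) = (LinearMap.range f).mkQ x.1 := fun x => rfl
  have hq : ∀ b, (q ((LinearMap.range f).mkQ b)).1 = g b := fun b => rfl
  refine ⟨p, q, ⟨?_, ?_, ?_⟩, hp, hq⟩
  · rw [injective_iff_map_eq_zero]
    intro x hx
    obtain ⟨b, rfl⟩ := Submodule.mkQ_surjective _ x
    rw [hp, Submodule.mkQ_apply, Submodule.Quotient.mk_eq_zero] at hx
    rw [Submodule.mkQ_apply, Submodule.Quotient.mk_eq_zero]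
    exact hx
  · intro x
    obtain ⟨b, rfl⟩ := Submodule.mkQ_surjective _ x
    rw [Subtype.ext_iff, hq]
    constructor
    · intro hb
      exact ⟨Submodule.mkQ _ ⟨b, hb⟩, hp _⟩
    · rintro ⟨y, hy⟩
      obtain ⟨c, rfl⟩ := Submodule.mkQ_surjective _ y
      rw [hp] at hy
      have : (q ((LinearMap.range f).mkQ c.1)).1 = (q ((LinearMap.range f).mkQ b)).1 := by rw [hy]
      rw [hq, hq] at this
      rw [← this]; exact c.2
  · rintro ⟨_, b, rfl⟩
    exact ⟨(LinearMap.range f).mkQ b, rfl⟩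

lemma ses_range (g : B →ₗ[R] C) : SES (LinearMap.range g).subtype (LinearMap.range g).mkQ := by
  refine ⟨Subtype.val_injective, ?_, Submodule.mkQ_surjective _⟩
  intro x
  rw [Submodule.mkQ_apply, Submodule.Quotient.mk_eq_zero]
  simp

lemma exists_desc {s : B →ₗ[R] C} (hs : Function.Surjective s) (ι : X →ₗ[R] (B →ₗ[R] Y))
    (h : ∀ k b, s b = 0 → ι k b = 0) :
    ∃ θ : X →ₗ[R] (C →ₗ[R] Y), ∀ k b, θ k (s b) = ι k b := by
  have hi : ∀ x, s (Function.surjInv hs x) = x := Function.surjInv_eq hs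
  have h' : ∀ k b b', s b = s b' → ι k b = ι k b' := by
    intro k b b' hb
    have := h k (b - b') (by rw [map_sub, hb, sub_self])
    rwa [map_sub, sub_eq_zero] at this
  refine ⟨LinearMap.mk₂ R (fun k x => ι k (Function.surjInv hs x)) ?_ ?_ ?_ ?_, ?_⟩
  · intro k k' x; simp
  · intro c k x; simp
  · intro k x y
    rw [← map_add]
    exact h' _ _ _ (by simp [hi])
  · intro c k x
    rw [← map_smul]
    exact h' _ _ _ (by simp [hi])
  · intro k b
    exact h' _ _ _ (hi _)

/-- case `d = 0`. -/
lemma dual_zero {ω : Type} [AddCommGroup ω] [Module R ω] {f : A →ₗ[R] B} {g : B →ₗ[R] C}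
    (h : ∀ x, g (f x) = 0) (h1 : Subsingleton (EX R (LinearMap.range g) ω 1))
    (h2 : Subsingleton (EX R (cok g) ω 1)) :
    Nonempty (Hmid (preH g ω) (preH f ω) ≃ₗ[R] (Hmid f g →ₗ[R] ω)) := by
  obtain ⟨p, q, hs, hp, hq⟩ := ses_hmid h
  obtain ⟨θ, hθ⟩ := exists_desc (Submodule.mkQ_surjective (LinearMap.range f))
    (LinearMap.ker (preH f ω)).subtype (by
      intro φ b hb
      rw [Submodule.mkQ_apply, Submodule.Quotient.mk_eq_zero] at hb
      obtain ⟨x, rfl⟩ := hb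
      exact LinearMap.congr_fun (LinearMap.mem_ker.1 φ.2) x)
  obtain ⟨σ, hσ⟩ : ∃ σ : LinearMap.ker (preH f ω) →ₗ[R] (Hmid f g →ₗ[R] ω),
      ∀ φ x, σ φ (Submodule.mkQ _ x) = φ.1 x.1 := by
    refine ⟨preH p ω ∘ₗ θ, fun φ x => ?_⟩
    refine (congrArg (θ φ) (hp x)).trans ?_
    exact hθ φ x.1
  refine hmid_equiv _ _ σ ?_ ?_
  · intro ψ
    obtain ⟨χ, hχ⟩ := hs.extend h1 ψ
    refine ⟨⟨χ ∘ₗ (LinearMap.range f).mkQ, ?_⟩, ?_⟩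
    · rw [LinearMap.mem_ker]
      ext x
      change χ ((LinearMap.range f).mkQ (f x)) = 0
      rw [show (LinearMap.range f).mkQ (f x) = 0 by simp, map_zero]
    · rw [← hχ]
      apply LinearMap.ext
      intro z
      obtain ⟨c, rfl⟩ := Submodule.mkQ_surjective _ z
      rw [hσ]
      exact (congrArg χ (hp c)).symm
  · intro φ
    constructor
    · intro h0
      have hk : LinearMap.ker g.rangeRestrict ≤ LinearMap.ker φ.1 := by
        intro x hx
        have hx' : g x = 0 := by simpa using hx
        have := hσ φ ⟨x, hx'⟩
        rw [h0] at this
        exact this.symm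
      obtain ⟨ψ, hψ⟩ := (ses_range g).extend h2
        (((LinearMap.ker g.rangeRestrict).liftQ φ.1 hk) ∘ₗ
          (g.rangeRestrict.quotKerEquivOfSurjective g.surjective_rangeRestrict).symm.toLinearMap)
      refine ⟨ψ, ?_⟩
      ext b
      have := LinearMap.congr_fun hψ (g.rangeRestrict b)
      refine (this.trans ?_)
      change ((LinearMap.ker g.rangeRestrict).liftQ φ.1 hk)
        ((g.rangeRestrict.quotKerEquivOfSurjective g.surjective_rangeRestrict).symm
          (g.rangeRestrict b)) = φ.1 b
      rw [show (g.rangeRestrict.quotKerEquivOfSurjective g.surjective_rangeRestrict).symm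
        (g.rangeRestrict b) = (LinearMap.ker g.rangeRestrict).mkQ b from by
          rw [LinearEquiv.symm_apply_eq]; rfl]
      rfl
    · rintro ⟨ψ, hψ⟩
      apply LinearMap.ext
      intro z
      obtain ⟨c, rfl⟩ := Submodule.mkQ_surjective _ z
      rw [hσ, ← hψ]
      change ψ (g c.1) = 0
      rw [LinearMap.mem_ker.1 c.2, map_zero]

/-- case `d ≥ 1`, first step. -/
lemma dual_pos {ω : Type} [AddCommGroup ω] [Module R ω] {f : A →ₗ[R] B} {g : B →ₗ[R] C}
    (h : ∀ x, g (f x) = 0) (h1 : Subsingleton (EX R (Hmid f g) ω 0))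
    (h2 : Subsingleton (EX R C ω 1)) :
    Nonempty (Hmid (preH g ω) (preH f ω) ≃ₗ[R] EX R (cok g) ω 1) := by
  obtain ⟨p, q, hs, hp, hq⟩ := ses_hmid h
  obtain ⟨δ, hδ, hδ0⟩ := (ses_range g).ext1_pre ω h2
  have h1' : Subsingleton (Hmid f g →ₗ[R] ω) := (homE _ _).injective.subsingleton
  have hk : ∀ φ : LinearMap.ker (preH f ω), ∀ b, g b = 0 → φ.1 b = 0 := by
    intro φ b hb
    have : (LinearMap.range f).liftQ φ.1 (by
        rintro _ ⟨x, rfl⟩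
        exact LinearMap.congr_fun (LinearMap.mem_ker.1 φ.2) x) ∘ₗ p = 0 := Subsingleton.elim _ _
    have := LinearMap.congr_fun this (Submodule.mkQ _ ⟨b, hb⟩)
    rw [LinearMap.comp_apply, hp] at this
    exact this
  obtain ⟨θ, hθ⟩ := exists_desc g.surjective_rangeRestrict
    (LinearMap.ker (preH f ω)).subtype (by
      intro φ b hb
      exact hk φ b (congrArg Subtype.val hb))
  refine hmid_equiv _ _ (δ ∘ₗ θ) (hδ.comp ?_) ?_
  · intro ψ
    refine ⟨⟨ψ ∘ₗ g.rangeRestrict, ?_⟩, ?_⟩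
    · rw [LinearMap.mem_ker]
      ext x
      change ψ (g.rangeRestrict (f x)) = 0
      rw [show g.rangeRestrict (f x) = 0 from Subtype.ext (h x), map_zero]
    · apply LinearMap.ext
      rintro ⟨_, b, rfl⟩
      exact hθ _ b
  · intro φ
    refine (hδ0 (θ φ)).trans (exists_congr fun ψ => ?_)
    constructor
    · intro h3
      ext b
      exact (LinearMap.congr_fun h3 (g.rangeRestrict b)).trans (hθ φ b)
    · intro h3
      apply LinearMap.ext
      rintro ⟨_, b, rfl⟩
      exact (LinearMap.congr_fun h3 b).trans (hθ φ b).symm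

lemma duality {ω : Type} [AddCommGroup ω] [Module R ω] (hω : FinInj R ω) (d : ℕ)
    (K : ℤ → ModuleCat.{0} R) (κ : ∀ n, K n →ₗ[R] K (n + 1)) (hκ : ∀ n x, κ (n + 1) (κ n x) = 0)
    (hK : ∀ n j, Subsingleton (EX R (K n) ω (j + 1)))
    (hH : ∀ n j, j ≠ d → Subsingleton (EX R (Hmid (κ n) (κ (n + 1))) ω j)) (n n' : ℤ)
    (hn : n' = n + d) :
    Nonempty (Hmid (preH (κ (n + 1)) ω) (preH (κ n) ω) ≃ₗ[R]
      EX R (Hmid (κ n') (κ (n' + 1))) ω d) := by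
  have hBsub : ∀ n j, Subsingleton (EX R (cok (κ (n + 1))) ω (j + 2)) →
      Subsingleton (EX R (LinearMap.range (κ (n + 1))) ω (j + 1)) := fun n j h =>
    (ses_range (κ (n + 1))).pre_sub_left ω (j + 1) (hK _ j) h
  have hC : ∀ n j, d < j → Subsingleton (EX R (cok (κ n)) ω j) := by
    obtain ⟨s, hs⟩ := hω
    have key : ∀ k j : ℕ, d < j → s < j + k → ∀ n, Subsingleton (EX R (cok (κ n)) ω j) := by
      intro k
      induction k with
      | zero => intro j _ hj n; exact hs (ModuleCat.of R (cok (κ n))) _ (by omega)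
      | succ k ih =>
        intro j hd hj n
        obtain ⟨j, rfl⟩ : ∃ j', j = j' + 1 := ⟨j - 1, by omega⟩
        obtain ⟨p, q, hs, -, -⟩ := ses_hmid (hκ n)
        exact hs.pre_sub_mid ω (j + 1) (hH n _ (by omega))
          (hBsub n j (ih (j + 2) (by omega) (by omega) _))
    exact fun n j hj => key (s + 1) j hj (by omega) n
  rcases Nat.eq_zero_or_pos d with rfl | hd
  · obtain rfl : n' = n := by simpa using hn
    obtain ⟨e⟩ := dual_zero (ω := ω) (hκ n') (hBsub n' 0 (hC _ 2 (by omega)))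
      (hC _ 1 (by omega))
    exact ⟨e.trans (homE _ _)⟩
  · obtain ⟨e1⟩ := dual_pos (ω := ω) (hκ n) (hH n 0 (by omega)) (hK _ 0)
    have key : ∀ j : ℕ, j + 1 ≤ d → ∀ m m' : ℤ, m' = m + j →
        Nonempty (EX R (cok (κ m)) ω 1 ≃ₗ[R] EX R (cok (κ m')) ω (j + 1)) := by
      intro j
      induction j with
      | zero => intro _ m m' h
                obtain rfl : m' = m := by simpa using h
                exact ⟨LinearEquiv.refl _ _⟩
      | succ j ih =>
        intro hj m m' h
        obtain ⟨a1⟩ := ih (by omega) m (m + j) rfl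
        obtain rfl : m' = m + j + 1 := by rw [h]; push_cast; ring
        obtain ⟨p, q, hs, -, -⟩ := ses_hmid (hκ (m + j))
        obtain ⟨a2⟩ := hs.pre_iso_g ω j (hH _ _ (by omega)) (hH _ _ (by omega))
        obtain ⟨a3⟩ := (ses_range (κ (m + j + 1))).shift_pre ω (j + 1) (hK _ j) (hK _ (j + 1))
        exact ⟨a1.trans (a2.symm.trans a3)⟩
    obtain ⟨d, rfl⟩ : ∃ d', d = d' + 1 := ⟨d - 1, by omega⟩
    obtain ⟨e2⟩ := key d le_rfl (n + 1) n' (by rw [hn]; push_cast; ring)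
    obtain ⟨p, q, hs, -, -⟩ := ses_hmid (hκ n')
    obtain ⟨e3⟩ := hs.pre_iso_f ω (d + 1) (hBsub _ _ (hC _ _ (by omega)))
      (hBsub _ _ (hC _ _ (by omega)))
    exact ⟨e1.trans (e2.trans e3)⟩

/-- `Hom(Hom(T,N),ω) → Hom(N, Hom(T^*,ω))` -/
def psi (T N ω : Type) [AddCommGroup T] [Module R T] [AddCommGroup N] [Module R N]
    [AddCommGroup ω] [Module R ω] :
    ((T →ₗ[R] N) →ₗ[R] ω) →ₗ[R] (N →ₗ[R] ((T →ₗ[R] R) →ₗ[R] ω)) where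
  toFun G := LinearMap.mk₂ R (fun n l => G ((LinearMap.toSpanSingleton R N n) ∘ₗ l))
    (by intro n n' l; rw [← map_add]; congr 1; ext t; simp)
    (by intro c n l; rw [← map_smul]; congr 1; ext t; simp [smul_comm c])
    (by intro n l l'; rw [← map_add]; congr 1; ext t; simp [add_smul])
    (by intro c n l; rw [← map_smul]; congr 1; ext t; simp [mul_smul])
  map_add' := by intro G G'; ext n l; rfl
  map_smul' := by intro c G; ext n l; rfl

lemma psi_apply (G : (A →ₗ[R] X) →ₗ[R] Y) (n : X) (l : A →ₗ[R] R) :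
    psi A X Y G n l = G ((LinearMap.toSpanSingleton R X n) ∘ₗ l) := rfl

lemma psi_bij (h : Summ R R A) : Function.Bijective (psi (R := R) A X Y) := by
  obtain ⟨r, a, b, hab⟩ := h
  have hx : ∀ x, ∑ j, b j (a j x) = x := fun x => by
    simpa using congrArg (fun f => f x) hab
  have hb : ∀ j (c : R), b j c = c • b j 1 := fun j c => by rw [← map_smul]; simp
  have hl : ∀ l : A →ₗ[R] R, ∑ j, l (b j 1) • a j = l := fun l => by
    ext x
    conv_rhs => rw [← hx x, map_sum]
    simp only [LinearMap.coe_sum, Finset.sum_apply, LinearMap.smul_apply, smul_eq_mul]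
    refine Finset.sum_congr rfl fun j _ => ?_
    rw [hb j (a j x), map_smul, smul_eq_mul, mul_comm]
  refine Function.bijective_iff_has_inverse.2
    ⟨fun H => ∑ j, (LinearMap.applyₗ (a j)) ∘ₗ H ∘ₗ (LinearMap.applyₗ (b j 1)), ?_, ?_⟩
  · intro G
    apply LinearMap.ext
    intro φ
    simp only [LinearMap.coe_sum, Finset.sum_apply, LinearMap.comp_apply, LinearMap.applyₗ_apply_apply,
      psi_apply]
    rw [← map_sum]
    congr 1
    ext x
    conv_rhs => rw [← hx x, map_sum]
    simp only [LinearMap.coe_sum, Finset.sum_apply]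
    refine Finset.sum_congr rfl fun j _ => ?_
    rw [hb j (a j x), map_smul]; rfl
  · intro H
    ext n l
    simp only [psi_apply, LinearMap.coe_sum, Finset.sum_apply, LinearMap.comp_apply,
      LinearMap.applyₗ_apply_apply, LinearMap.toSpanSingleton_apply, map_smul]
    simp only [← map_smul]
    rw [← map_sum, hl]

/-- `Hom(Hom(T,N),ω) ≃ Hom(N, T ⊗ ω)` -/
def psiE (h : Summ R R A) (X Y : Type) [AddCommGroup X] [Module R X] [AddCommGroup Y]
    [Module R Y] : ((A →ₗ[R] X) →ₗ[R] Y) ≃ₗ[R] (X →ₗ[R] TensorProduct R A Y) :=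
  (LinearEquiv.ofBijective (psi A X Y) (psi_bij h)).trans
    (LinearEquiv.congrRight (LinearEquiv.ofBijective (evm A Y) (evm_bij h)).symm)

lemma psiE_spec (h : Summ R R A) (G : (A →ₗ[R] X) →ₗ[R] Y) (n : X) :
    evm A Y (psiE h X Y G n) = psi A X Y G n :=
  (LinearEquiv.ofBijective (evm A Y) (evm_bij h)).apply_symm_apply _

lemma psiE_nat (hA : Summ R R A) (hB : Summ R R B) (u : A →ₗ[R] B) (G : (A →ₗ[R] X) →ₗ[R] Y) :
    psiE hB X Y (preH (preH u X) Y G) = postH X (u.rTensor Y) (psiE hA X Y G) := by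
  ext n
  apply (evm_bij (Y := Y) hB).1
  rw [psiE_spec]
  change _ = evm B Y (u.rTensor Y (psiE hA X Y G n))
  rw [evm_nat, psiE_spec]
  rfl

/-- main duality -/
lemma phi3 {ω N : Type} [AddCommGroup ω] [Module R ω] [AddCommGroup N] [Module R N]
    (hω : FinInj R ω) (d : ℕ) (K : TA R)
    (hN : ∀ j, Subsingleton (EX R N ω (j + 1)))
    (hH : ∀ (n : ℤ) (j : ℕ), j ≠ d → Subsingleton (EX R (EX R (K.Q n) N 1) ω j)) (n n' : ℤ)
    (hn : n' = n + d) :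
    Nonempty (EX R (EX R (K.Q n') N 1) ω d ≃ₗ[R]
      EX R N (TensorProduct R (K.Q (n + 1 + 1 + 1)) ω) 1) := by
  have hE : ∀ n, Nonempty (Hmid (preH (K.t n) N) (preH (K.t (n + 1)) N) ≃ₗ[R]
      EX R (K.Q n) N 1) := fun n => hmid_pre (K.ex n) N (K.ext_T n 0)
  obtain ⟨e1⟩ := hE n'
  obtain ⟨e2⟩ := duality hω d (fun n => ModuleCat.of R (K.T n →ₗ[R] N)) (fun n => preH (K.t n) N)
    (by
      intro n φ
      ext x
      change φ (K.t n (K.t (n + 1) x)) = 0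
      rw [(K.ex n).apply_apply_eq_zero, map_zero])
    (fun n j => ((K.summ n).hom N).ext_left ω (j + 1) (hN j))
    (by
      intro n j hj
      obtain ⟨e⟩ := hE n
      have := hH n j hj
      exact (preEquiv e ω j).symm.injective.subsingleton) n n' hn
  obtain ⟨e3⟩ := hmid_congr (f := preH (preH (K.t (n + 1)) N) ω) (g := preH (preH (K.t n) N) ω)
    (f' := postH N ((K.t (n + 1)).rTensor ω)) (g' := postH N ((K.t n).rTensor ω))
    (psiE (K.summ (n + 1 + 1)) N ω) (psiE (K.summ (n + 1)) N ω) (psiE (K.summ n) N ω)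
    (psiE_nat _ _ _) (psiE_nat _ _ _)
  obtain ⟨e4⟩ := hmid_post (K.ses_tensor hω (n + 1 + 1)) (K.ses_tensor hω (n + 1)).inj
    (f := (K.t (n + 1)).rTensor ω) (g := (K.t n).rTensor ω)
    (by rw [← LinearMap.rTensor_comp]; rfl) (K.tensor_exact hω n) N
    (((K.summ (n + 1 + 1)).tensor ω).ext_right _ _ (hN 0))
  exact ⟨(preEquiv e1 ω d).trans (e2.symm.trans (e3.trans e4))⟩

end partD

end ARD

namespace ARD
section partE1
open scoped Pointwise

variable {R : Type} [CommRing R]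
variable {A B C W X Y L : Type} [AddCommGroup A] [Module R A] [AddCommGroup B] [Module R B]
    [AddCommGroup C] [Module R C] [AddCommGroup W] [Module R W] [AddCommGroup X] [Module R X]
    [AddCommGroup Y] [Module R Y] [AddCommGroup L] [Module R L]

lemma pre_smul_id (r : R) (n : ℕ) (x : EX R A Y n) :
    pre (r • (LinearMap.id : A →ₗ[R] A)) Y n x = r • x := by
  have h : ModuleCat.ofHom (r • (LinearMap.id : A →ₗ[R] A)) = r • 𝟙 (ModuleCat.of R A) := rfl
  rw [pre_apply, h, Abelian.Ext.mk₀_smul, Abelian.Ext.smul_comp, Abelian.Ext.mk₀_id_comp]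

lemma post_smul_id (r : R) (n : ℕ) (x : EX R X A n) :
    post X (r • (LinearMap.id : A →ₗ[R] A)) n x = r • x := by
  have h : ModuleCat.ofHom (r • (LinearMap.id : A →ₗ[R] A)) = r • 𝟙 (ModuleCat.of R A) := rfl
  rw [post_apply, h, Abelian.Ext.mk₀_smul, Abelian.Ext.comp_smul, Abelian.Ext.comp_mk₀_id]

lemma ext_ann (r : R) (h : ∀ a : A, r • a = 0) (n : ℕ) (x : EX R A Y n) : r • x = 0 := by
  rw [← pre_smul_id]
  have : (r • (LinearMap.id : A →ₗ[R] A)) = 0 := by ext a; simp [h a]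
  rw [this, pre_apply]
  have h0 : ModuleCat.ofHom (0 : A →ₗ[R] A) = 0 := rfl
  rw [h0, Abelian.Ext.mk₀_zero, Abelian.Ext.zero_comp]

lemma ses_mul (r : R) (h : IsSMulRegular W r) :
    SES (r • (LinearMap.id : W →ₗ[R] W)) (Submodule.mkQ (r • (⊤ : Submodule R W))) where
  inj := by intro x y hxy; exact h (by simpa using hxy)
  ex := by
    intro x
    simp only [Submodule.mkQ_apply, Submodule.Quotient.mk_eq_zero]
    constructor
    · intro hx
      obtain ⟨y, -, hy⟩ := (Submodule.mem_smul_pointwise_iff_exists _ _ _).1 hx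
      exact ⟨y, by simpa using hy⟩
    · rintro ⟨y, hy⟩
      exact (Submodule.mem_smul_pointwise_iff_exists _ _ _).2 ⟨y, trivial, by simpa using hy⟩
  surj := Submodule.mkQ_surjective _

lemma ses_sub (N : Submodule R W) : SES N.subtype N.mkQ where
  inj := N.injective_subtype
  ex := by
    intro x; simp
  surj := N.mkQ_surjective

/-- Ext out of a module killed by a weakly regular sequence. -/
lemma reg_ext (rs : List R) : ∀ {W : Type} [AddCommGroup W] [Module R W],
    RingTheory.Sequence.IsWeaklyRegular W rs → (∀ r ∈ rs, ∀ a : L, r • a = 0) →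
    (∀ j < rs.length, Subsingleton (EX R L W j)) ∧
    Nonempty (EX R L W rs.length ≃ₗ[R] (L →ₗ[R] (W ⧸ (Ideal.ofList rs • (⊤ : Submodule R W))))) := by
  induction rs with
  | nil =>
    intro W _ _ hW hL
    refine ⟨fun j hj => absurd hj (Nat.not_lt_zero _), ⟨(homE L W).symm.trans
      (LinearEquiv.congrRight (M := L) (Submodule.quotEquivOfEqBot
        (Ideal.ofList ([] : List R) • (⊤ : Submodule R W)) (by simp)).symm)⟩⟩
  | cons r rs ih =>
    intro W _ _ hW hL
    rw [RingTheory.Sequence.isWeaklyRegular_cons_iff] at hW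
    obtain ⟨h1, ⟨e⟩⟩ := ih hW.2 (fun s hs => hL s (List.mem_cons_of_mem _ hs))
    have hses := ses_mul r hW.1
    have hz : ∀ n (x : EX R L W n), post L (r • (LinearMap.id : W →ₗ[R] W)) n x = 0 := by
      intro n x
      rw [post_smul_id]
      exact ext_ann r (hL r List.mem_cons_self) n x
    have h0 : ∀ j < rs.length + 1, Subsingleton (EX R L W j) := by
      intro j hj
      rcases j with _ | j
      · refine subsingleton_of_forall_eq 0 fun x => ?_
        obtain ⟨φ, rfl⟩ := (homE L W).surjective x
        have : φ = 0 := by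
          ext a
          apply hW.1
          simp only [LinearMap.zero_apply, smul_zero]
          rw [← map_smul, hL r List.mem_cons_self, map_zero]
        rw [this, map_zero]
      · obtain ⟨δ, e1, e2⟩ := hses.exists_post L j
        have := h1 j (by omega)
        refine subsingleton_of_forall_eq 0 fun x => ?_
        obtain ⟨y, hy⟩ := (e2 x).1 (hz _ x)
        rw [← hy, Subsingleton.elim y 0, map_zero]
    refine ⟨h0, ?_⟩
    obtain ⟨δ, e1, e2⟩ := hses.exists_post L rs.length
    have := h0 rs.length (by omega)
    have hb : Function.Bijective δ := by
      constructor
      · rw [injective_iff_map_eq_zero]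
        intro x hx
        obtain ⟨y, hy⟩ := (e1 x).1 hx
        rw [← hy, Subsingleton.elim y 0, map_zero]
      · intro x
        exact (e2 x).1 (hz _ x)
    exact ⟨(LinearEquiv.ofBijective δ hb).symm.trans (e.trans
      (LinearEquiv.congrRight
        (Submodule.quotOfListConsSMulTopEquivQuotSMulTopInner W r rs).symm))⟩

/-- Bounded Ext passes to quotients by weakly regular sequences. -/
lemma quot_ext (rs : List R) : ∀ {X : Type} [AddCommGroup X] [Module R X] (a : ℕ),
    RingTheory.Sequence.IsWeaklyRegular X rs → (∀ j, a < j → Subsingleton (EX R X Y j)) →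
    ∀ j, a + rs.length < j →
      Subsingleton (EX R (X ⧸ (Ideal.ofList rs • (⊤ : Submodule R X))) Y j) := by
  induction rs with
  | nil =>
    intro X _ _ a hX h j hj
    have := h j (by simpa using hj)
    exact (preEquiv (Submodule.quotEquivOfEqBot (Ideal.ofList ([] : List R) • (⊤ : Submodule R X))
      (by simp)) Y j).symm.toEquiv.subsingleton
  | cons r rs ih =>
    intro X _ _ a hX h j hj
    rw [RingTheory.Sequence.isWeaklyRegular_cons_iff] at hX
    have h' : ∀ j, a + 1 < j → Subsingleton (EX R (QuotSMulTop r X) Y j) := by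
      intro j hj
      obtain ⟨j, rfl⟩ : ∃ i, j = i + 1 := ⟨j - 1, by omega⟩
      exact (ses_mul r hX.1).pre_sub_right Y j (h j (by omega)) (h (j + 1) (by omega))
    have := ih (a + 1) hX.2 h' j (by simp at hj; omega)
    exact (preEquiv (Submodule.quotOfListConsSMulTopEquivQuotSMulTopInner X r rs).symm
      Y j).toEquiv.subsingleton

lemma nak [IsLocalRing R] [Module.Finite R X] (r : R) (hr : r ∈ IsLocalRing.maximalIdeal R)
    (h : ∀ x : X, ∃ y, r • y = x) : Subsingleton X := by
  have : (⊤ : Submodule R X) = ⊥ := by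
    apply Submodule.eq_bot_of_le_smul_of_le_jacobson_bot (IsLocalRing.maximalIdeal R) _
      Module.Finite.fg_top
    · intro x _
      obtain ⟨y, rfl⟩ := h x
      exact Submodule.smul_mem_smul hr trivial
    · exact IsLocalRing.maximalIdeal_le_jacobson _
  rw [← Submodule.subsingleton_iff R]
  exact subsingleton_of_bot_eq_top this.symm

/-- Converse to `quot_ext`, by Nakayama. -/
lemma ext_of_quot [IsNoetherianRing R] [IsLocalRing R] [Module.Finite R Y] (rs : List R) :
    ∀ {X : Type} [AddCommGroup X] [Module R X] [Module.Finite R X] (d : ℕ),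
    RingTheory.Sequence.IsWeaklyRegular X rs → (∀ r ∈ rs, r ∈ IsLocalRing.maximalIdeal R) →
    (∀ j, d < j → Subsingleton (EX R (X ⧸ (Ideal.ofList rs • (⊤ : Submodule R X))) Y j)) →
    ∀ j, d < j + rs.length → Subsingleton (EX R X Y j) := by
  induction rs with
  | nil =>
    intro X _ _ _ d hX hm h j hj
    have := h j (by simpa using hj)
    exact (preEquiv (Submodule.quotEquivOfEqBot (Ideal.ofList ([] : List R) • (⊤ : Submodule R X))
      (by simp)) Y j).toEquiv.subsingleton
  | cons r rs ih =>
    intro X _ _ _ d hX hm h j hj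
    rw [RingTheory.Sequence.isWeaklyRegular_cons_iff] at hX
    have h' := ih (X := QuotSMulTop r X) d hX.2 (fun s hs => hm s (List.mem_cons_of_mem _ hs))
      (fun j hj => by
        have := h j hj
        exact (preEquiv (Submodule.quotOfListConsSMulTopEquivQuotSMulTopInner X r rs)
          Y j).toEquiv.subsingleton)
    obtain ⟨δ, e1, e2⟩ := (ses_mul r hX.1).exists_pre Y j
    have := h' (j + 1) (by simp at hj; omega)
    have : Module.Finite R (EX R X Y j) := ModuleCat.finite_ext R _ _ j
    refine nak r (hm r List.mem_cons_self) fun x => ?_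
    obtain ⟨y, hy⟩ := (e1 x).1 (Subsingleton.elim _ _)
    exact ⟨y, by rw [← hy, pre_smul_id]⟩

/-- Hom into a quotient by a regular sequence. -/
lemma hom_quot {V : Type} [AddCommGroup V] [Module R V] (rs : List R) :
    ∀ {W : Type} [AddCommGroup W] [Module R W],
    RingTheory.Sequence.IsWeaklyRegular W rs → (∀ j, Subsingleton (EX R V W (j + 1))) →
    Nonempty ((V →ₗ[R] (W ⧸ (Ideal.ofList rs • (⊤ : Submodule R W)))) ≃ₗ[R]
      ((V →ₗ[R] W) ⧸ (Ideal.ofList rs • (⊤ : Submodule R (V →ₗ[R] W))))) := by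
  induction rs with
  | nil =>
    intro W _ _ hW h
    exact ⟨(LinearEquiv.congrRight (Submodule.quotEquivOfEqBot _ (by simp))).trans
      (Submodule.quotEquivOfEqBot _ (by simp)).symm⟩
  | cons r rs ih =>
    intro W _ _ hW h
    rw [RingTheory.Sequence.isWeaklyRegular_cons_iff] at hW
    have hs := ses_mul r hW.1
    obtain ⟨e⟩ := ih (W := QuotSMulTop r W) hW.2
      (fun j => hs.post_sub_right V (j + 1) (h j) (h (j + 1)))
    have e2 : Nonempty ((V →ₗ[R] QuotSMulTop r W) ≃ₗ[R] QuotSMulTop r (V →ₗ[R] W)) := by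
      have hk : LinearMap.ker (postH V (Submodule.mkQ (r • (⊤ : Submodule R W)))) =
          r • (⊤ : Submodule R (V →ₗ[R] W)) := by
        ext φ
        rw [LinearMap.mem_ker, Submodule.mem_smul_pointwise_iff_exists]
        constructor
        · intro hφ
          have hφ' : ∀ v, ∃ w, r • w = φ v := fun v => by
            obtain ⟨w, hw⟩ := (hs.ex (φ v)).1 (LinearMap.congr_fun hφ v)
            exact ⟨w, by simpa using hw⟩
          choose ψ hψ using hφ'
          refine ⟨{ toFun := ψ, map_add' := ?_, map_smul' := ?_ }, trivial, ?_⟩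
          · intro x y
            apply hW.1
            simp only [smul_add, hψ, map_add]
          · intro s x
            apply hW.1
            simp only [RingHom.id_apply]
            rw [smul_comm r s, hψ, hψ, map_smul]
          · ext v; exact hψ v
        · rintro ⟨ψ, -, rfl⟩
          ext v
          exact (hs.ex _).2 ⟨ψ v, by simp⟩
      have hsurj : Function.Surjective (postH V (Submodule.mkQ (r • (⊤ : Submodule R W)))) := by
        intro φ
        obtain ⟨ψ, hψ⟩ := hs.lift (h 0) φ
        exact ⟨ψ, hψ⟩
      exact ⟨((Submodule.quotEquivOfEq _ _ hk.symm).trans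
        (LinearMap.quotKerEquivOfSurjective _ hsurj)).symm⟩
    obtain ⟨e2⟩ := e2
    have e3 := Submodule.Quotient.equiv (Ideal.ofList rs • (⊤ : Submodule R (V →ₗ[R] QuotSMulTop r W)))
      (Ideal.ofList rs • (⊤ : Submodule R (QuotSMulTop r (V →ₗ[R] W)))) e2
      (by rw [Submodule.map_smul'']; simp)
    exact ⟨(LinearEquiv.congrRight
        (Submodule.quotOfListConsSMulTopEquivQuotSMulTopInner W r rs)).trans (e.trans (e3.trans
        (Submodule.quotOfListConsSMulTopEquivQuotSMulTopInner (V →ₗ[R] W) r rs).symm))⟩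

end partE1
end ARD

namespace ARD
section partE2

variable {R : Type} [CommRing R] [IsLocalRing R]

lemma fl_ind (P : ∀ (L : Type) [AddCommGroup L] [Module R L], Prop)
    (h0 : ∀ (L : Type) [AddCommGroup L] [Module R L], Subsingleton L → P L)
    (h1 : ∀ (L : Type) [AddCommGroup L] [Module R L] (N : Submodule R L), IsFiniteLength R N →
      Nonempty ((L ⧸ N) ≃ₗ[R] (R ⧸ IsLocalRing.maximalIdeal R)) → P N → P L)
    (L : Type) [AddCommGroup L] [Module R L] (hL : IsFiniteLength R L) : P L := by
  induction hL with
  | of_subsingleton => exact h0 _ inferInstance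
  | @of_simple_quotient M _ _ N hs hN ih =>
    obtain ⟨I, hI, ⟨e⟩⟩ := isSimpleModule_iff_quot_maximal.1 hs
    obtain rfl := IsLocalRing.eq_maximalIdeal hI
    exact h1 _ N hN ⟨e⟩ ih

/-- `F2`. -/
lemma fl_quot [IsNoetherianRing R] (d : ℕ) {W : Type} [AddCommGroup W] [Module R W]
    [Module.Finite R W] (hdim : Module.supportDim R W = d) (rs : List R) (hl : rs.length = d)
    (hr : RingTheory.Sequence.IsRegular W rs) :
    IsFiniteLength R (W ⧸ (Ideal.ofList rs • (⊤ : Submodule R W))) := by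
  have h := Module.supportDim_add_length_eq_supportDim_of_isRegular rs hr
  rw [hdim, hl, Module.supportDim_eq_ringKrullDim_quotient_annihilator] at h
  set Q := W ⧸ (Ideal.ofList rs • (⊤ : Submodule R W)) with hQ
  have h0 : ringKrullDim (R ⧸ Module.annihilator R Q) ≤ 0 := by
    generalize ringKrullDim (R ⧸ Module.annihilator R Q) = a at h
    induction a with
    | bot => simp
    | coe a =>
      induction a with
      | top =>
        exfalso
        have : ((⊤ : ℕ∞) : WithBot ℕ∞) + ((d : ℕ∞) : WithBot ℕ∞) = ((d : ℕ∞) : WithBot ℕ∞) := h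
        rw [← WithBot.coe_add, WithBot.coe_inj] at this
        simp at this
      | coe a =>
        have : a + d = d := by exact_mod_cast h
        have : a = 0 := by omega
        subst this; simp
  have hA : IsArtinianRing (R ⧸ Module.annihilator R Q) := by
    rw [isArtinianRing_iff_isNoetherianRing_krullDimLE_zero]
    exact ⟨inferInstance, (Ring.krullDimLE_iff).2 (by simpa using h0)⟩
  rw [isFiniteLength_iff_isNoetherian_isArtinian]
  refine ⟨inferInstance, ?_⟩
  let _ : Module (R ⧸ Module.annihilator R Q) Q := Module.quotientAnnihilator
  have : IsScalarTower R (R ⧸ Module.annihilator R Q) Q := inferInstance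
  have : Module.Finite (R ⧸ Module.annihilator R Q) Q := Module.Finite.of_restrictScalars_finite R _ _
  have : IsArtinian (R ⧸ Module.annihilator R Q) Q := inferInstance
  exact isArtinian_of_surjective_algebraMap (R := R ⧸ Module.annihilator R Q) Ideal.Quotient.mk_surjective

lemma depth_attained {W : Type} [AddCommGroup W] [Module R W] [Nontrivial W] (d : ℕ)
    (h : sSup {c : ℕ∞ | ∃ rs : List R, c = rs.length ∧
      (∀ r ∈ rs, r ∈ IsLocalRing.maximalIdeal R) ∧ RingTheory.Sequence.IsRegular W rs} = d) :
    ∃ rs : List R, rs.length = d ∧ (∀ r ∈ rs, r ∈ IsLocalRing.maximalIdeal R) ∧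
      RingTheory.Sequence.IsRegular W rs := by
  rcases Nat.eq_zero_or_pos d with rfl | hd
  · exact ⟨[], rfl, by simp, by simp [RingTheory.Sequence.isRegular_iff]⟩
  · by_contra hc
    push Not at hc
    have : sSup {c : ℕ∞ | ∃ rs : List R, c = rs.length ∧
      (∀ r ∈ rs, r ∈ IsLocalRing.maximalIdeal R) ∧ RingTheory.Sequence.IsRegular W rs} ≤
        ((d - 1 : ℕ) : ℕ∞) := by
      apply sSup_le
      rintro c ⟨rs, rfl, h1, h2⟩
      have h3 : (rs.length : ℕ∞) ≤ d := by
        rw [← h]; exact le_sSup ⟨rs, rfl, h1, h2⟩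
      have h3 : rs.length ≤ d := by exact_mod_cast h3
      have h4 : rs.length ≠ d := fun h4 => hc rs h4 h1 h2
      have : rs.length ≤ d - 1 := by omega
      exact_mod_cast this
    rw [h] at this
    have : d ≤ d - 1 := by exact_mod_cast this
    omega

variable {L : Type} [AddCommGroup L] [Module R L] {ω : Type} [AddCommGroup ω] [Module R ω]

lemma fl_ext (n : ℕ) (hk : Subsingleton (EX R (R ⧸ IsLocalRing.maximalIdeal R) ω n))
    (hL : IsFiniteLength R L) : Subsingleton (EX R L ω n) := by
  refine fl_ind (R := R) (fun L _ _ => Subsingleton (EX R L ω n)) ?_ ?_ L hL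
  · intro L _ _ hL
    refine subsingleton_of_forall_eq 0 fun x => ?_
    rw [← pre_id n x]
    have : (LinearMap.id : L →ₗ[R] L) = (0 : R) • LinearMap.id := by
      ext x; exact Subsingleton.elim _ _
    rw [this, pre_smul_id, zero_smul]
  · intro L _ _ N hN ⟨e⟩ h
    exact (ses_sub N).pre_sub_mid ω n h ((preEquiv e.symm ω n).toEquiv.subsingleton)

lemma k_ann (r : R) (hr : r ∈ IsLocalRing.maximalIdeal R) (a : R ⧸ IsLocalRing.maximalIdeal R) :
    r • a = 0 := by
  obtain ⟨a, rfl⟩ := Submodule.Quotient.mk_surjective _ a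
  rw [← Submodule.Quotient.mk_smul, Submodule.Quotient.mk_eq_zero]
  exact Ideal.mul_mem_right _ _ hr

/-- `F4`. -/
lemma fl_ext_lt (rs : List R) (hm : ∀ r ∈ rs, r ∈ IsLocalRing.maximalIdeal R)
    (hr : RingTheory.Sequence.IsWeaklyRegular ω rs) (hL : IsFiniteLength R L) (j : ℕ)
    (hj : j < rs.length) : Subsingleton (EX R L ω j) :=
  fl_ext j ((reg_ext rs hr (fun r h a => k_ann r (hm r h) a)).1 j hj) hL

/-- A simple submodule of a nontrivial finite length module. -/
lemma exists_socle (hL : IsFiniteLength R L) (hn : Nontrivial L) :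
    ∃ f : (R ⧸ IsLocalRing.maximalIdeal R) →ₗ[R] L, Function.Injective f := by
  have := (isFiniteLength_iff_isNoetherian_isArtinian.1 hL).2
  obtain ⟨S, hS⟩ := IsAtomic.exists_atom (Submodule R L)
  have := isSimpleModule_iff_isAtom.2 hS
  obtain ⟨I, hI, ⟨e⟩⟩ := isSimpleModule_iff_quot_maximal.1 this
  obtain rfl := IsLocalRing.eq_maximalIdeal hI
  exact ⟨S.subtype ∘ₗ e.symm.toLinearMap, S.injective_subtype.comp e.symm.injective⟩

/-- `F5`. -/
lemma fl_ext_gt [IsNoetherianRing R] (d : ℕ) (hdim : ringKrullDim R = d) (ys : List R) (hl : ys.length = d)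
    (hy : RingTheory.Sequence.IsRegular R ys)
    (hω : FinInj R ω) (hL : IsFiniteLength R L) (j : ℕ)
    (hj : d < j) : Subsingleton (EX R L ω j) := by
  obtain ⟨s, hs⟩ := hω
  have hfl := fl_quot d (by rw [Module.supportDim_self_eq_ringKrullDim, hdim]) ys hl hy
  have hnt : Nontrivial (R ⧸ (Ideal.ofList ys • (⊤ : Submodule R R))) :=
    Submodule.Quotient.nontrivial_iff.2 ((RingTheory.Sequence.isRegular_iff _ _).1 hy).2.symm
  obtain ⟨f, hf⟩ := exists_socle hfl hnt
  have hy2 := quot_ext (Y := ω) ys 0 hy.1 (fun j hj => by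
    obtain ⟨j, rfl⟩ : ∃ i, j = i + 1 := ⟨j - 1, by omega⟩
    exact ext_proj j)
  have key : ∀ t j, d < j → s < j + t →
      Subsingleton (EX R (R ⧸ IsLocalRing.maximalIdeal R) ω j) := by
    intro t
    induction t with
    | zero => intro j _ hj; exact hs (ModuleCat.of R _) j hj
    | succ t ih =>
      intro j hdj hj
      have hses : SES f (LinearMap.range f).mkQ :=
        ⟨hf, by intro x; simp, Submodule.mkQ_surjective _⟩
      refine hses.pre_sub_left ω j (hy2 j (by omega)) ?_
      exact fl_ext _ (ih (j + 1) (by omega) (by omega))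
        (hfl.of_surjective (Submodule.mkQ_surjective _))
  exact fl_ext _ (key (s + 1) j hj (by omega)) hL

end partE2
end ARD

namespace ARD
section partE3
set_option linter.unusedSectionVars false

variable {R : Type} [CommRing R]

lemma bij_of_length {A B : Type} [AddCommGroup A] [Module R A] [AddCommGroup B] [Module R B]
    (f : A →ₗ[R] B) (hf : Function.Injective f) (h : Module.length R A = Module.length R B)
    (hA : Module.length R A ≠ ⊤) : Function.Bijective f := by
  refine ⟨hf, ?_⟩
  have h1 := Module.length_eq_add_of_exact f (LinearMap.range f).mkQ hf (Submodule.mkQ_surjective _)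
    (by intro x; simp)
  rw [← h] at h1
  have h2 : Module.length R (B ⧸ LinearMap.range f) = 0 := by
    generalize Module.length R (B ⧸ LinearMap.range f) = b at h1
    generalize Module.length R A = a at h1 hA
    lift a to ℕ using hA
    induction b with
    | top => simp at h1
    | coe b =>
      have : a = a + b := by exact_mod_cast h1
      have : b = 0 := by omega
      simp [this]
  rw [Module.length_eq_zero_iff] at h2
  rw [← LinearMap.range_eq_top]
  exact Submodule.Quotient.subsingleton_iff.1 h2

variable [IsLocalRing R]

lemma length_k : Module.length R (R ⧸ IsLocalRing.maximalIdeal R) = 1 := by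
  have : IsSimpleModule R (R ⧸ IsLocalRing.maximalIdeal R) :=
    isSimpleModule_iff_quot_maximal.2 ⟨_, inferInstance, ⟨LinearEquiv.refl _ _⟩⟩
  exact Module.length_eq_one R _

/-- Data of a canonical module. -/
structure Can (R : Type) [CommRing R] [IsLocalRing R] (ω : Type) [AddCommGroup ω] [Module R ω]
    (d : ℕ) : Prop where
  fin : FinInj R ω
  e : Nonempty ((ω →ₗ[R] ω) ≃ₗ[R] R)
  dim : ringKrullDim R = d
  xs : ∃ rs : List R, rs.length = d ∧ (∀ r ∈ rs, r ∈ IsLocalRing.maximalIdeal R) ∧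
      RingTheory.Sequence.IsRegular ω rs
  ys : ∃ rs : List R, rs.length = d ∧ (∀ r ∈ rs, r ∈ IsLocalRing.maximalIdeal R) ∧
      RingTheory.Sequence.IsRegular R rs

section can
variable [IsNoetherianRing R] {ω : Type} [AddCommGroup ω] [Module R ω] [Module.Finite R ω] {d : ℕ}
  {L : Type} [AddCommGroup L] [Module R L]

lemma Can.ann (h : Can R ω d) : ∀ r : R, r • (LinearMap.id : ω →ₗ[R] ω) = 0 → r = 0 := by
  obtain ⟨e⟩ := h.e
  intro r hr
  apply e.symm.injective
  rw [map_zero]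
  ext x
  have h1 : e.symm r = r • e.symm 1 := by rw [← map_smul]; simp
  rw [h1, LinearMap.smul_apply, ← LinearMap.map_smul]
  have h2 := LinearMap.congr_fun hr x
  simp only [LinearMap.smul_apply, LinearMap.id_apply, LinearMap.zero_apply] at h2
  simp [h2]

lemma Can.sdim (h : Can R ω d) : Module.supportDim R ω = d := by
  have : Module.annihilator R ω = ⊥ := by
    rw [eq_bot_iff]
    intro r hr
    rw [Module.mem_annihilator] at hr
    exact h.ann r (by ext x; simp [hr x])
  rw [Module.supportDim_eq_ringKrullDim_quotient_annihilator, this, ← h.dim]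
  exact ringKrullDim_eq_of_ringEquiv (RingEquiv.quotientBot R)

lemma Can.ext_lt (h : Can R ω d) (hL : IsFiniteLength R L) (j : ℕ) (hj : j < d) :
    Subsingleton (EX R L ω j) := by
  obtain ⟨xs, hl, hm, hx⟩ := h.xs
  exact fl_ext_lt xs hm hx.1 hL j (by omega)

lemma Can.ext_gt (h : Can R ω d) (hL : IsFiniteLength R L) (j : ℕ) (hj : d < j) :
    Subsingleton (EX R L ω j) := by
  obtain ⟨xs, hl, hm, hx⟩ := h.ys
  exact fl_ext_gt d h.dim xs hl hx h.fin hL j hj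

lemma Can.ext_ne (h : Can R ω d) (hL : IsFiniteLength R L) (j : ℕ) (hj : j ≠ d) :
    Subsingleton (EX R L ω j) := by
  rcases Nat.lt_or_gt_of_ne hj with h1 | h1
  · exact h.ext_lt hL j h1
  · exact h.ext_gt hL j h1

/-- `F7`. -/
lemma Can.self (h : Can R ω d) (n : ℕ) : Subsingleton (EX R ω ω (n + 1)) := by
  obtain ⟨xs, hl, hm, hx⟩ := h.xs
  exact ext_of_quot xs d hx.1 hm (fun j hj => h.ext_gt (fl_quot d h.sdim xs hl hx) j hj) (n + 1)
    (by omega)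

lemma Can.length (h : Can R ω d) (hL : IsFiniteLength R L) :
    Module.length R (EX R L ω d) =
      Module.length R L * Module.length R (EX R (R ⧸ IsLocalRing.maximalIdeal R) ω d) := by
  refine fl_ind (R := R) (fun L _ _ => Module.length R (EX R L ω d) =
      Module.length R L * Module.length R (EX R (R ⧸ IsLocalRing.maximalIdeal R) ω d)) ?_ ?_ L hL
  · intro L _ _ hL
    have h1 : Subsingleton (EX R L ω d) := by
      refine subsingleton_of_forall_eq 0 fun x => ?_
      rw [← one_smul R x]
      exact ext_ann 1 (fun a => Subsingleton.elim _ _) d x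
    rw [Module.length_eq_zero_iff.2 h1, Module.length_eq_zero_iff.2 hL, zero_mul]
  · intro L _ _ N hN ⟨e⟩ ih
    have hs := ses_sub N
    have hk : IsFiniteLength R (R ⧸ IsLocalRing.maximalIdeal R) := by
      rw [← Module.length_ne_top_iff, length_k]; simp
    have hQ : IsFiniteLength R (L ⧸ N) := by
      rw [← Module.length_ne_top_iff, e.length_eq, length_k]; simp
    have h1 : Function.Injective (pre N.mkQ ω d) := by
      rcases Nat.eq_zero_or_pos d with h0 | h0
      · rw [h0, injective_iff_map_eq_zero]
        intro x hx
        obtain ⟨φ, rfl⟩ := (homE (L ⧸ N) ω).surjective x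
        rw [pre_homE, LinearEquiv.map_eq_zero_iff] at hx
        have : φ = 0 := by
          ext y
          exact LinearMap.congr_fun hx y
        rw [this, map_zero]
      · obtain ⟨d', rfl⟩ : ∃ d', d = d' + 1 := ⟨d - 1, by omega⟩
        obtain ⟨δ, e1, e2⟩ := hs.exists_pre ω d'
        have := h.ext_lt hN d' (by omega)
        rw [injective_iff_map_eq_zero]
        intro x hx
        obtain ⟨y, rfl⟩ := (e2 x).1 hx
        rw [Subsingleton.elim y 0, map_zero]
    have h2 : Function.Surjective (pre N.subtype ω d) := by
      obtain ⟨δ, e1, e2⟩ := hs.exists_pre ω d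
      have := h.ext_gt hQ (d + 1) (by omega)
      intro x
      exact (e1 x).1 (Subsingleton.elim _ _)
    have h3 := Module.length_eq_add_of_exact _ _ h1 h2 (hs.pre_exact ω d)
    have h4 := Module.length_eq_add_of_exact _ _ hs.inj hs.surj hs.ex
    rw [← (preEquiv e ω d).length_eq, ih] at h3
    rw [e.length_eq, length_k] at h4
    rw [h3, h4, add_mul, one_mul, add_comm]

/-- Maps into a quotient by annihilating elements. -/
lemma hom_quot_left (I : Ideal R) {V : Type} [AddCommGroup V] [Module R V]
    (hL : ∀ r ∈ I, ∀ x : L, r • x = 0) :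
    Nonempty (((V ⧸ (I • (⊤ : Submodule R V))) →ₗ[R] L) ≃ₗ[R] (V →ₗ[R] L)) := by
  refine ⟨LinearEquiv.ofBijective (preH (Submodule.mkQ (I • (⊤ : Submodule R V))) L) ⟨?_, ?_⟩⟩
  · intro φ ψ hφ
    ext y
    exact LinearMap.congr_fun hφ y
  · intro φ
    refine ⟨Submodule.liftQ _ φ ?_, ?_⟩
    · rw [Submodule.smul_le]
      intro r hr x _
      rw [LinearMap.mem_ker, map_smul, hL r hr]
    · ext x; rfl

lemma quot_ann (I : Ideal R) {V : Type} [AddCommGroup V] [Module R V] (r : R) (hr : r ∈ I)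
    (x : V ⧸ (I • (⊤ : Submodule R V))) : r • x = 0 := by
  obtain ⟨x, rfl⟩ := Submodule.Quotient.mk_surjective _ x
  rw [← Submodule.Quotient.mk_smul, Submodule.Quotient.mk_eq_zero]
  exact Submodule.smul_mem_smul hr trivial

lemma hom_fl (hL : IsFiniteLength R L) : IsFiniteLength R (ω →ₗ[R] L) := by
  obtain ⟨n, f, hf⟩ := Module.Finite.exists_fin' R ω
  have h1 : IsFiniteLength R (Fin n → L) := by
    rw [isFiniteLength_iff_isNoetherian_isArtinian] at hL ⊢
    obtain ⟨_, _⟩ := hL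
    exact ⟨inferInstance, inferInstance⟩
  have h2 : IsFiniteLength R ((Fin n → R) →ₗ[R] L) :=
    h1.of_injective (f := (LinearMap.pi fun i => LinearMap.applyₗ (Pi.single i (1 : R))))
      (by
        intro φ ψ h
        apply LinearMap.pi_ext'
        intro i
        ext
        exact congrFun h i)
  refine h2.of_injective (f := preH f L) ?_
  intro φ ψ h
  ext x
  obtain ⟨y, rfl⟩ := hf x
  exact LinearMap.congr_fun h y

/-- `F8`. -/
lemma Can.type_one (h : Can R ω d) :
    Module.length R (EX R (R ⧸ IsLocalRing.maximalIdeal R) ω d) = 1 := by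
  obtain ⟨xs, hl, hm, hx⟩ := h.xs
  obtain ⟨e⟩ := h.e
  set I := Ideal.ofList xs with hI
  have hxI : ∀ r ∈ xs, r ∈ I := fun r hr => Ideal.subset_span hr
  set W := ω ⧸ (I • (⊤ : Submodule R ω)) with hW
  set S := R ⧸ (I • (⊤ : Submodule R R)) with hS
  have hWfl : IsFiniteLength R W := fl_quot d h.sdim xs hl hx
  have hWnt : Nontrivial W :=
    Submodule.Quotient.nontrivial_iff.2 ((RingTheory.Sequence.isRegular_iff _ _).1 hx).2.symm
  obtain ⟨a1⟩ := (reg_ext (L := W) xs hx.1 (fun r hr x => quot_ann I r (hxI r hr) x)).2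
  obtain ⟨a2⟩ := (reg_ext (L := S) xs hx.1 (fun r hr x => quot_ann I r (hxI r hr) x)).2
  obtain ⟨b1⟩ := hom_quot_left (V := ω) I (L := W) (fun r hr x => quot_ann I r hr x)
  obtain ⟨b2⟩ := hom_quot_left (V := R) I (L := W) (fun r hr x => quot_ann I r hr x)
  obtain ⟨c1⟩ := hom_quot (V := ω) xs hx.1 h.self
  have c2 : ((ω →ₗ[R] ω) ⧸ (I • (⊤ : Submodule R (ω →ₗ[R] ω)))) ≃ₗ[R] S :=
    Submodule.Quotient.equiv _ _ e (by rw [Submodule.map_smul'']; simp)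
  rw [hl] at a1 a2
  have hSfl : IsFiniteLength R S := (c1.trans c2).isFiniteLength (hom_fl hWfl)
  have l1 := h.length hWfl
  have l2 := h.length hSfl
  rw [a1.length_eq, b1.length_eq, (c1.trans c2).length_eq] at l1
  rw [a2.length_eq, b2.length_eq, (LinearMap.ringLmapEquivSelf R R W).length_eq] at l2
  have n1 : Module.length R W ≠ 0 := by
    rw [ne_eq, Module.length_eq_zero_iff]
    exact not_subsingleton W
  have n2 := Module.length_ne_top_iff.2 hWfl
  have n3 := Module.length_ne_top_iff.2 hSfl
  rw [l1] at l2
  generalize Module.length R (EX R (R ⧸ IsLocalRing.maximalIdeal R) ω d) = t at *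
  generalize Module.length R W = w at *
  rw [l1] at n3
  lift w to ℕ using n2
  have hw : w ≠ 0 := by simpa using n1
  induction t with
  | top => simp [hw] at n3
  | coe t =>
    have h1 : w = w * t * t := by exact_mod_cast l2
    have h2 : t * t = 1 := by
      have : w * (t * t) = w * 1 := by rw [← mul_assoc, ← h1, mul_one]
      exact Nat.eq_of_mul_eq_mul_left (by omega) this
    have : t = 1 := Nat.eq_one_of_mul_eq_one_left h2
    simp [this]

end can
end partE3
end ARD

namespace ARD
section partE4
set_option linter.unusedSectionVars false

/-- Unbundled injective envelope data. -/
structure Env (R : Type) [CommRing R] [IsLocalRing R] (E : Type) [AddCommGroup E] [Module R E] :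
    Prop where
  inj : Injective (ModuleCat.of R E)
  ex : ∃ ι : (R ⧸ IsLocalRing.maximalIdeal R) →ₗ[R] E, Function.Injective ι ∧
    ∀ N : Submodule R E, N ≠ ⊥ → N ⊓ LinearMap.range ι ≠ ⊥

variable {R : Type} [CommRing R] [IsLocalRing R] {E : Type} [AddCommGroup E] [Module R E]
  {L : Type} [AddCommGroup L] [Module R L]

lemma Env.ext (h : Env R E) (X : Type) [AddCommGroup X] [Module R X] (n : ℕ) :
    Subsingleton (EX R X E (n + 1)) := by
  have := h.inj
  exact Abelian.Ext.subsingleton_of_injective _ _ _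

lemma Env.extend (h : Env R E) {A B : Type} [AddCommGroup A] [Module R A] [AddCommGroup B]
    [Module R B] (f : A →ₗ[R] B) (hf : Function.Injective f) (φ : A →ₗ[R] E) :
    ∃ ψ : B →ₗ[R] E, ψ ∘ₗ f = φ := by
  have hses : SES f (LinearMap.range f).mkQ :=
        ⟨hf, by intro x; simp, Submodule.mkQ_surjective _⟩
  exact hses.extend (h.ext _ 0) φ

lemma Env.length_k (h : Env R E) :
    Module.length R ((R ⧸ IsLocalRing.maximalIdeal R) →ₗ[R] E) = 1 := by
  obtain ⟨ι, hι, hess⟩ := h.ex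
  have one_ne : (Submodule.Quotient.mk 1 : R ⧸ IsLocalRing.maximalIdeal R) ≠ 0 := by
    rw [ne_eq, Submodule.Quotient.mk_eq_zero]
    exact (Ideal.ne_top_iff_one _).1 (IsLocalRing.maximalIdeal.isMaximal R).ne_top
  have hmem : ∀ φ : (R ⧸ IsLocalRing.maximalIdeal R) →ₗ[R] E,
      φ (Submodule.Quotient.mk 1) ∈ LinearMap.range ι := by
    intro φ
    by_cases h0 : φ (Submodule.Quotient.mk 1) = 0
    · rw [h0]; exact Submodule.zero_mem _
    · have h1 := hess (Submodule.span R {φ (Submodule.Quotient.mk 1)})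
        (by simpa [Submodule.span_singleton_eq_bot] using h0)
      obtain ⟨y, hy, hy0⟩ := Submodule.exists_mem_ne_zero_of_ne_bot h1
      obtain ⟨hy1, hy2⟩ := hy
      obtain ⟨r, rfl⟩ := Submodule.mem_span_singleton.1 hy1
      by_cases hr : r ∈ IsLocalRing.maximalIdeal R
      · exfalso
        apply hy0
        rw [← map_smul, k_ann r hr, map_zero]
      · have hu : IsUnit r := by simpa using hr
        obtain ⟨u, rfl⟩ := hu
        have := Submodule.smul_mem _ ((u⁻¹ : Rˣ) : R) hy2
        simpa [smul_smul] using this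
  have hinj : ∀ φ ψ : (R ⧸ IsLocalRing.maximalIdeal R) →ₗ[R] E,
      φ (Submodule.Quotient.mk 1) = ψ (Submodule.Quotient.mk 1) → φ = ψ := by
    intro φ ψ hφ
    ext
    exact hφ
  let ev : ((R ⧸ IsLocalRing.maximalIdeal R) →ₗ[R] E) →ₗ[R] LinearMap.range ι :=
    LinearMap.codRestrict _ (LinearMap.applyₗ (Submodule.Quotient.mk 1)) hmem
  have l1 := Module.length_le_of_injective ev (by
    intro φ ψ hφ
    exact hinj φ ψ (congrArg Subtype.val hφ))
  rw [← (LinearEquiv.ofInjective ι hι).length_eq, ARD.length_k] at l1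
  refine le_antisymm l1 ?_
  rw [ENat.one_le_iff_ne_zero, ne_eq, Module.length_eq_zero_iff]
  intro hs
  have : ι = 0 := Subsingleton.elim _ _
  apply one_ne
  apply hι
  rw [this]; simp

/-- `F9`. -/
lemma Env.length (h : Env R E) (hL : IsFiniteLength R L) :
    Module.length R (L →ₗ[R] E) = Module.length R L := by
  refine fl_ind (R := R) (fun L _ _ => Module.length R (L →ₗ[R] E) = Module.length R L) ?_ ?_ L hL
  · intro L _ _ hL
    have : Subsingleton (L →ₗ[R] E) := ⟨fun φ ψ => by
      ext x; rw [Subsingleton.elim x 0, map_zero, map_zero]⟩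
    rw [Module.length_eq_zero, Module.length_eq_zero]
  · intro L _ _ N hN ⟨e⟩ ih
    have hs := ses_sub N
    have h3 := Module.length_eq_add_of_exact (preH N.mkQ E) (preH N.subtype E)
      (by
        intro φ ψ hφ
        ext y
        exact LinearMap.congr_fun hφ y)
      (by
        intro φ
        obtain ⟨ψ, hψ⟩ := h.extend N.subtype N.injective_subtype φ
        exact ⟨ψ, hψ⟩)
      (by
        intro φ
        constructor
        · intro hφ
          refine ⟨N.liftQ φ ?_, ?_⟩
          · intro x hx
            exact LinearMap.congr_fun hφ ⟨x, hx⟩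
          · ext x; rfl
        · rintro ⟨ψ, rfl⟩
          ext x
          have : (Submodule.Quotient.mk (x : L) : L ⧸ N) = 0 := by simp
          change ψ (Submodule.Quotient.mk (x : L)) = 0
          rw [this, map_zero])
    have h4 := Module.length_eq_add_of_exact _ _ hs.inj hs.surj hs.ex
    rw [ih, (LinearEquiv.congrLeft E R e).length_eq, h.length_k] at h3
    rw [e.length_eq, ARD.length_k] at h4
    rw [h3, h4, add_comm]

/-- `F11`. -/
lemma Env.bidual (h : Env R E) (hL : IsFiniteLength R L) :
    Nonempty (L ≃ₗ[R] ((L →ₗ[R] E) →ₗ[R] E)) := by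
  have hH : IsFiniteLength R (L →ₗ[R] E) := by
    rw [← Module.length_ne_top_iff, h.length hL, Module.length_ne_top_iff]; exact hL
  refine ⟨LinearEquiv.ofBijective (LinearMap.applyₗ : L →ₗ[R] ((L →ₗ[R] E) →ₗ[R] E))
    (bij_of_length _ ?_ ?_ (Module.length_ne_top_iff.2 hL))⟩
  · rw [injective_iff_map_eq_zero]
    intro x hx
    by_contra hx0
    obtain ⟨ι, hι, -⟩ := h.ex
    have hle : LinearMap.ker (LinearMap.toSpanSingleton R L x) ≤ IsLocalRing.maximalIdeal R := by
      apply IsLocalRing.le_maximalIdeal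
      rw [Ideal.ne_top_iff_one]
      intro h1
      rw [LinearMap.mem_ker] at h1
      apply hx0
      simpa using h1
    let f : (R ⧸ LinearMap.ker (LinearMap.toSpanSingleton R L x)) →ₗ[R] L :=
      Submodule.liftQ _ (LinearMap.toSpanSingleton R L x) le_rfl
    have hf : Function.Injective f := by
      rw [← LinearMap.ker_eq_bot]
      exact Submodule.ker_liftQ_eq_bot _ _ _ le_rfl
    obtain ⟨ψ, hψ⟩ := h.extend f hf (ι ∘ₗ Submodule.mapQ _ (IsLocalRing.maximalIdeal R)
      (LinearMap.id) hle)
    have h1 := LinearMap.congr_fun hψ (Submodule.Quotient.mk 1)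
    have h2 : f (Submodule.Quotient.mk 1) = x := by
      change LinearMap.toSpanSingleton R L x 1 = x
      simp
    rw [LinearMap.comp_apply, h2] at h1
    have h3 : ψ x = 0 := LinearMap.congr_fun hx ψ
    rw [h3] at h1
    have h4 : ι (Submodule.Quotient.mk 1) = ι 0 := by
      rw [map_zero]; exact h1.symm
    have h5 := hι h4
    rw [Submodule.Quotient.mk_eq_zero] at h5
    exact (Ideal.ne_top_iff_one _).1 (IsLocalRing.maximalIdeal.isMaximal R).ne_top h5
  · rw [h.length hH, h.length hL]

/-- `F10`. -/
lemma Can.dual [IsNoetherianRing R] {ω : Type} [AddCommGroup ω] [Module R ω] [Module.Finite R ω]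
    {d : ℕ} (h : Can R ω d) (hE : Env R E) (hL : IsFiniteLength R L) :
    Nonempty (EX R L ω d ≃ₗ[R] (L →ₗ[R] E)) := by
  rcases subsingleton_or_nontrivial L with hs | hn
  · have h1 : Subsingleton (EX R L ω d) := by
      refine subsingleton_of_forall_eq 0 fun x => ?_
      rw [← one_smul R x]
      exact ext_ann 1 (fun a => Subsingleton.elim _ _) d x
    have h2 : Subsingleton (L →ₗ[R] E) := ⟨fun φ ψ => by
      ext x; rw [Subsingleton.elim x 0, map_zero, map_zero]⟩
    exact ⟨0⟩
  have hfin : Module.Finite R L := by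
    have := (isFiniteLength_iff_isNoetherian_isArtinian.1 hL).1
    infer_instance
  have hωn : Nontrivial ω := by
    obtain ⟨xs, -, -, hx⟩ := h.xs
    exact hx.nontrivial
  have hIm : Module.annihilator R L ≤ IsLocalRing.maximalIdeal R := by
    apply IsLocalRing.le_maximalIdeal
    rw [Ideal.ne_top_iff_one, Module.mem_annihilator]
    intro h1
    obtain ⟨x, hx⟩ := exists_ne (0 : L)
    exact hx (by simpa using h1 x)
  have hlt : Module.annihilator R L • (⊤ : Submodule R ω) < ⊤ := by
    rw [lt_top_iff_ne_top]
    intro heq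
    have : (⊤ : Submodule R ω) = ⊥ :=
      Submodule.eq_bot_of_le_smul_of_le_jacobson_bot (Module.annihilator R L) _
        Module.Finite.fg_top heq.ge (hIm.trans (IsLocalRing.maximalIdeal_le_jacobson _))
    exact top_ne_bot this
  obtain ⟨rs, hl, hrI, hr⟩ := ModuleCat.exists_isRegular_of_exists_subsingleton_ext
    (Module.annihilator R L) d (ModuleCat.of R ω) hlt (ModuleCat.of R L)
    (Module.support_eq_zeroLocus (R := R) (M := L)) (fun i hi => h.ext_lt hL i hi)
  change RingTheory.Sequence.IsRegular ω rs at hr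
  subst hl
  obtain ⟨a1⟩ := (reg_ext (L := L) rs hr.1
    (fun r hr x => Module.mem_annihilator.1 (hrI r hr) x)).2
  obtain ⟨a2⟩ := (reg_ext (L := R ⧸ IsLocalRing.maximalIdeal R) rs hr.1
    (fun r hr x => k_ann r (hIm (hrI r hr)) x)).2
  have hWfl := fl_quot _ h.sdim rs rfl hr
  set W := ω ⧸ (Ideal.ofList rs • (⊤ : Submodule R ω)) with hW
  have hWnt : Nontrivial W :=
    Submodule.Quotient.nontrivial_iff.2 ((RingTheory.Sequence.isRegular_iff _ _).1 hr).2.symm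
  obtain ⟨f, hf⟩ := exists_socle hWfl hWnt
  have hone := h.type_one
  rw [a2.length_eq, Module.length_eq_one_iff] at hone
  obtain ⟨ι, hι, -⟩ := hE.ex
  obtain ⟨φ, hφ⟩ := hE.extend f hf ι
  have one_ne : (Submodule.Quotient.mk 1 : R ⧸ IsLocalRing.maximalIdeal R) ≠ 0 := by
    rw [ne_eq, Submodule.Quotient.mk_eq_zero]
    exact (Ideal.ne_top_iff_one _).1 (IsLocalRing.maximalIdeal.isMaximal R).ne_top
  have hφi : Function.Injective φ := by
    rw [← LinearMap.ker_eq_bot]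
    by_contra hker
    have hnt : Nontrivial (LinearMap.ker φ) := Submodule.nontrivial_iff_ne_bot.2 hker
    obtain ⟨g, hg⟩ := exists_socle
      (hWfl.of_injective (LinearMap.ker φ).injective_subtype) hnt
    have hf0 : f ≠ 0 := by
      rintro rfl
      exact one_ne (hf (by simp))
    obtain ⟨r, hr⟩ := IsSimpleModule.toSpanSingleton_surjective R hf0
      ((LinearMap.ker φ).subtype ∘ₗ g)
    have h1 := LinearMap.congr_fun hr (Submodule.Quotient.mk 1)
    simp only [LinearMap.toSpanSingleton_apply, LinearMap.smul_apply, LinearMap.comp_apply,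
      Submodule.subtype_apply] at h1
    have h2 : φ (r • f (Submodule.Quotient.mk 1)) = 0 := by
      rw [h1]; exact (g _).2
    rw [← map_smul, ← LinearMap.comp_apply, hφ] at h2
    have h3 : r • (Submodule.Quotient.mk 1 : R ⧸ IsLocalRing.maximalIdeal R) = 0 :=
      hι (by rw [h2, map_zero])
    rw [← map_smul, h3, map_zero] at h1
    apply one_ne
    apply hg
    rw [map_zero]
    exact Subtype.ext h1.symm
  have hlen : Module.length R (L →ₗ[R] W) = Module.length R (L →ₗ[R] E) := by
    rw [← a1.length_eq, h.length hL, h.type_one, mul_one, hE.length hL]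
  refine ⟨a1.trans (LinearEquiv.ofBijective (postH L φ) (bij_of_length _ ?_ hlen ?_))⟩
  · intro α β hαβ
    ext x
    exact hφi (LinearMap.congr_fun hαβ x)
  · rw [hlen, hE.length hL, Module.length_ne_top_iff]
    exact hL

end partE4
end ARD

namespace ARD
section partF

variable {R : Type} [CommRing R]

lemma exactAt_fun {ι : Type} {c : ComplexShape ι} (K : HomologicalComplex (ModuleCat.{0} R) c)
    (i j k : ι) (hi : c.prev j = i) (hk : c.next j = k) (h : K.ExactAt j) :
    Function.Exact (K.d i j).hom (K.d j k).hom := by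
  rw [K.exactAt_iff' i j k hi hk] at h
  exact (ShortComplex.ShortExact.moduleCat_exact_iff_function_exact _).1 h

lemma homology_hmid {ι : Type} {c : ComplexShape ι} (K : HomologicalComplex (ModuleCat.{0} R) c)
    (i j k : ι) (hi : c.prev j = i) (hk : c.next j = k) :
    Nonempty (K.homology j ≃ₗ[R] Hmid (K.d i j).hom (K.d j k).hom) := by
  have e1 : K.homology j ≅ (K.sc' i j k).homology :=
    ShortComplex.homologyMapIso (K.isoSc' i j k hi hk)
  have e2 := (K.sc' i j k).moduleCatHomologyIso
  refine ⟨(e1 ≪≫ e2).toLinearEquiv ≪≫ₗ Submodule.quotEquivOfEq _ _ ?_⟩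
  ext ⟨x, hx⟩
  constructor
  · rintro ⟨y, hy⟩
    exact ⟨y, congrArg Subtype.val hy⟩
  · rintro ⟨y, hy⟩
    exact ⟨y, Subtype.ext hy⟩

lemma up_prev (i j : ℤ) (h : j = i + 1) : (ComplexShape.up ℤ).prev j = i :=
  (ComplexShape.up ℤ).prev_eq' (by simp [h])
lemma up_next (i j : ℤ) (h : j = i + 1) : (ComplexShape.up ℤ).next i = j :=
  (ComplexShape.up ℤ).next_eq' (by simp [h])
lemma down_prev (i j : ℤ) (h : j = i + 1) : (ComplexShape.down ℤ).prev i = j :=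
  (ComplexShape.down ℤ).prev_eq' (by simp [h])
lemma down_next (i j : ℤ) (h : j = i + 1) : (ComplexShape.down ℤ).next j = i :=
  (ComplexShape.down ℤ).next_eq' (by simp [h])

section
variable (T : ChainComplex (ModuleCat.{0} R) ℤ) (Y : Type) [AddCommGroup Y] [Module R Y]

/-- Hom identification -/
def yoE (i : ℤ) : ((T.linearYonedaObj R (ModuleCat.of R Y)).X i) ≃ₗ[R] (T.X i →ₗ[R] Y) :=
  ModuleCat.homLinearEquiv (S := R) (M := T.X i) (N := ModuleCat.of R Y)

lemma yoE_d (i j : ℤ) (x : (T.linearYonedaObj R (ModuleCat.of R Y)).X i) :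
    yoE T Y j (((T.linearYonedaObj R (ModuleCat.of R Y)).d i j).hom x) =
      preH (T.d j i).hom Y (yoE T Y i x) := by
  rfl
end

lemma proj_of (X : ModuleCat.{0} R) (h : Projective X) : Module.Projective R X :=
  (IsProjective.iff_projective (R := R) X).2 h

variable {M : ModuleCat.{0} R} (C : CompleteResolution R M)

/-- the totally acyclic complex of a complete resolution -/
def taOf : TA R where
  T i := C.T.X i
  t i := (C.T.d (i + 1) i).hom
  proj i := proj_of _ (C.projT i)
  fin i := C.fgT i
  ex i := exactAt_fun C.T (i + 1 + 1) (i + 1) i (down_prev _ _ rfl) (down_next _ _ rfl)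
    (C.exactT (i + 1))
  exd i := by
    have h := exactAt_fun (C.T.linearYonedaObj R (ModuleCat.of R R)) i (i + 1) (i + 1 + 1)
      (up_prev _ _ rfl) (up_next _ _ rfl) (C.exactTdual (i + 1))
    intro φ
    have h1 := h ((yoE C.T R (i + 1)).symm φ)
    constructor
    · intro hφ
      obtain ⟨x, hx⟩ := h1.1 (by
        apply (yoE C.T R (i + 1 + 1)).injective
        rw [yoE_d, LinearEquiv.apply_symm_apply, map_zero]
        exact hφ)
      refine ⟨yoE C.T R i x, ?_⟩
      have h2 := congrArg (yoE C.T R (i + 1)) hx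
      rw [yoE_d, LinearEquiv.apply_symm_apply] at h2
      exact h2
    · rintro ⟨x, rfl⟩
      ext a
      have h3 : (C.T.d (i + 1) i).hom ((C.T.d (i + 1 + 1) (i + 1)).hom a) = 0 := by
        exact congrArg (fun f => f.hom a) (C.T.d_comp_d (i + 1 + 1) (i + 1) i)
      change x ((C.T.d (i + 1) i).hom ((C.T.d (i + 1 + 1) (i + 1)).hom a)) = 0
      rw [h3, map_zero]

lemma tate (Y : Type) [AddCommGroup Y] [Module R Y] (i j : ℤ) (h : j = i + 1) :
    Nonempty (TateExt R C (ModuleCat.of R Y) j ≃ₗ[R] EX R ((taOf C).Q i) Y 1) := by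
  subst h
  obtain ⟨e1⟩ := homology_hmid (C.T.linearYonedaObj R (ModuleCat.of R Y)) i (i + 1) (i + 1 + 1)
      (up_prev _ _ rfl) (up_next _ _ rfl)
  obtain ⟨e2⟩ := hmid_congr (yoE C.T Y i) (yoE C.T Y (i + 1)) (yoE C.T Y (i + 1 + 1))
    (yoE_d C.T Y i (i + 1)) (yoE_d C.T Y (i + 1) (i + 1 + 1))
  obtain ⟨e3⟩ := hmid_pre ((taOf C).ex i) Y ((taOf C).ext_T i 0)
  exact ⟨e1.trans (e2.trans e3)⟩

/-- syzygies -/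
def syzU : ℕ → ModuleCat.{0} R
  | 0 => M
  | l + 1 => ModuleCat.of R (cok (C.P.d ((l + 2 : ℕ) : ℤ) ((l + 1 : ℕ) : ℤ)).hom)

lemma exP (i j k : ℤ) (h0 : 0 < j) (hi : i = j + 1) (hk : j = k + 1) :
    Function.Exact (C.P.d i j).hom (C.P.d j k).hom :=
  exactAt_fun C.P i j k (down_prev _ _ hi) (down_next _ _ hk) (C.exactP j h0)

lemma exP' (l : ℕ) : Function.Exact (C.P.d ((l + 2 : ℕ) : ℤ) ((l + 1 : ℕ) : ℤ)).hom
    (C.P.d ((l + 1 : ℕ) : ℤ) (l : ℤ)).hom :=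
  exP C _ _ _ (by positivity) (by push_cast; ring) (by push_cast; ring)

/-- inclusion of syzygies -/
def syzf (l : ℕ) : syzU C (l + 1) →ₗ[R] C.P.X (l : ℤ) := cokMap _ _ (exP' C l)

/-- projection to syzygies -/
def syzg : ∀ l : ℕ, C.P.X (l : ℤ) →ₗ[R] syzU C l
  | 0 => C.π.hom
  | l + 1 => (LinearMap.range (C.P.d ((l + 2 : ℕ) : ℤ) ((l + 1 : ℕ) : ℤ)).hom).mkQ

lemma ses_cok' {A B X Y : Type} [AddCommGroup A] [Module R A] [AddCommGroup B] [Module R B]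
    [AddCommGroup X] [Module R X] [AddCommGroup Y] [Module R Y]
    {u : A →ₗ[R] B} {v : B →ₗ[R] X} (h : Function.Exact u v) (p : X →ₗ[R] Y)
    (hp : Function.Surjective p) (hvp : Function.Exact v p) : SES (cokMap u v h) p where
  inj := (ses_cok h).inj
  ex := by
    intro x
    rw [hvp x]
    constructor
    · rintro ⟨y, rfl⟩
      exact ⟨Submodule.Quotient.mk y, cokMap_mk _ _ h y⟩
    · rintro ⟨y, rfl⟩
      obtain ⟨y, rfl⟩ := Submodule.Quotient.mk_surjective _ y
      exact ⟨y, (cokMap_mk _ _ h y).symm⟩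
  surj := hp

/-- the syzygy system of the projective resolution -/
def syzOf [Module.Finite R M] : Syz R where
  U := syzU C
  P l := C.P.X (l : ℤ)
  f := syzf C
  g := syzg C
  ses l := by
    cases l with
    | zero =>
      refine ses_cok' (exP' C 0) C.π.hom ?_ ?_
      · exact (ModuleCat.epi_iff_surjective C.π).1 C.epiπ
      · exact (ShortComplex.ShortExact.moduleCat_exact_iff_function_exact _).1 C.exact0
    | succ l => exact ses_cok (exP' C (l + 1))
  proj l := proj_of _ (C.projP l)
  fin l := C.fgP l
  finU l := by
    cases l with
    | zero => assumption
    | succ l =>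
      have := C.fgP ((l + 1 : ℕ) : ℤ)
      change Module.Finite R (cok (C.P.d ((l + 2 : ℕ) : ℤ) ((l + 1 : ℕ) : ℤ)).hom)
      infer_instance

lemma cok_iso (i i' j : ℤ) (h : i = i') (h1 : IsIso (C.θ.f i)) (h2 : IsIso (C.θ.f j)) :
    Nonempty (cok (C.T.d i j).hom ≃ₗ[R] cok (C.P.d i' j).hom) := by
  subst h
  let a := (asIso (C.θ.f i)).toLinearEquiv
  let b := (asIso (C.θ.f j)).toLinearEquiv
  have hc : ∀ x, b ((C.T.d i j).hom x) = (C.P.d i j).hom (a x) := by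
    intro x
    exact (congrArg (fun f => f.hom x) (C.θ.comm i j)).symm
  refine ⟨Submodule.Quotient.equiv _ _ b ?_⟩
  ext y
  constructor
  · rintro ⟨_, ⟨x, rfl⟩, rfl⟩
    exact ⟨a x, (hc x).symm⟩
  · rintro ⟨x, rfl⟩
    refine ⟨(C.T.d i j).hom (a.symm x), ⟨_, rfl⟩, ?_⟩
    change b _ = _
    rw [hc, a.apply_symm_apply]

lemma exists_syz [Module.Finite R M] :
    ∃ m : ℕ, Nonempty ((taOf C).Q (m : ℤ) ≃ₗ[R] (syzOf C).U m) := by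
  obtain ⟨n₀, h⟩ := C.iso_eventually
  refine ⟨n₀.toNat + 1, ?_⟩
  have := Int.self_le_toNat n₀
  exact cok_iso C _ _ _ (by push_cast; ring) (h _ (by push_cast; omega)) (h _ (by push_cast; omega))

lemma ext_of_inj (X : Type) [AddCommGroup X] [Module R X] (I : ModuleCat.{0} R) (hI : Injective I)
    (n : ℕ) : Subsingleton (EX R X I (n + 1)) :=
  Abelian.Ext.subsingleton_of_injective (ModuleCat.of R X) I n

lemma up_prevN (i : ℕ) : (ComplexShape.up ℕ).prev (i + 1) = i :=
  (ComplexShape.up ℕ).prev_eq' (by simp)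
lemma up_nextN (i : ℕ) : (ComplexShape.up ℕ).next i = i + 1 :=
  (ComplexShape.up ℕ).next_eq' (by simp)

lemma finInj_of (ω : Type) [AddCommGroup ω] [Module R ω]
    (h : HasFiniteInjDim R (ModuleCat.of R ω)) : FinInj R ω := by
  obtain ⟨n, I, ι, hI, hz, hm, ⟨w, hw⟩, hex⟩ := h
  have key : ∀ s l : ℕ, n < l + 1 + s → ∀ (X : ModuleCat.{0} R) (k : ℕ), s < k →
      Subsingleton (EX R X (cok (I.d l (l + 1)).hom) k) := by
    intro s
    induction s with
    | zero =>
      intro l hl X k hk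
      have h1 : Subsingleton (I.X (l + 1)) := ModuleCat.subsingleton_of_isZero (hz _ (by omega))
      have h2 : Subsingleton (cok (I.d l (l + 1)).hom) :=
        (Submodule.Quotient.mk_surjective _).subsingleton
      have h3 : Injective (ModuleCat.of R (cok (I.d l (l + 1)).hom)) :=
        (ModuleCat.isZero_of_subsingleton _).injective
      obtain ⟨k, rfl⟩ : ∃ k', k = k' + 1 := ⟨k - 1, by omega⟩
      exact ext_of_inj X _ h3 k
    | succ s ih =>
      intro l hl X k hk
      obtain ⟨k, rfl⟩ : ∃ k', k = k' + 1 := ⟨k - 1, by omega⟩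
      exact (ses_cok (exactAt_fun I l (l + 1) (l + 1 + 1) (up_prevN _) (up_nextN _)
        (hex _ (by omega)))).post_sub_left X k (ih (l + 1) (by omega) X k (by omega))
        (ext_of_inj X _ (hI _) k)
  have h0 : Function.Exact ι.hom (I.d 0 1).hom :=
    (ShortComplex.ShortExact.moduleCat_exact_iff_function_exact _).1 hw
  have hs : SES ι.hom (LinearMap.range ι.hom).mkQ :=
    { inj := (ModuleCat.mono_iff_injective ι).1 hm
      ex := fun x => by
        rw [Submodule.mkQ_apply, Submodule.Quotient.mk_eq_zero]; rfl
      surj := Submodule.mkQ_surjective _ }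
  refine ⟨n + 2, fun X k hk => ?_⟩
  obtain ⟨k, rfl⟩ : ∃ k', k = k' + 1 + 1 := ⟨k - 2, by omega⟩
  refine hs.post_sub_left X (k + 1) ?_ (ext_of_inj X _ (hI _) _)
  exact (ses_cok h0).post_sub_left X k (key n 0 (by omega) X k (by omega))
    (ext_of_inj X _ (hI _) _)

lemma nontriv_of [Nontrivial R] (ω : Type) [AddCommGroup ω] [Module R ω]
    (h : Nonempty ((ω →ₗ[R] ω) ≃ₗ[R] R)) : Nontrivial ω := by
  obtain ⟨e⟩ := h
  by_contra hn
  rw [not_nontrivial_iff_subsingleton] at hn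
  have : Subsingleton R := e.symm.injective.subsingleton
  exact not_subsingleton R this

theorem ar_main [IsNoetherianRing R] [IsLocalRing R] (d : ℕ)
    (hd : ringKrullDim R = d) (hCM : moduleDepth R R = d)
    (ω : Type) [AddCommGroup ω] [Module R ω] [Module.Finite R ω]
    (hω₁ : moduleDepth R ω = d) (hω₂ : HasFiniteInjDim R (ModuleCat.of R ω))
    (hω₃ : Nonempty ((ω →ₗ[R] ω) ≃ₗ[R] R))
    (M N : Type) [AddCommGroup M] [Module R M] [Module.Finite R M]
    [AddCommGroup N] [Module R N] [Module.Finite R N]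
    (E : Type) [AddCommGroup E] [Module R E] (hE : IsInjectiveEnvelopeOfResidueField R E)
    (C : CompleteResolution R (ModuleCat.of R M)) (C' : CompleteResolution R (ModuleCat.of R N))
    (hlen : ∀ i, IsFiniteLength R (TateExt R C (ModuleCat.of R N) i)) (i : ℤ) :
    Nonempty ((TateExt R C (ModuleCat.of R N) i) ≃ₗ[R]
      ((TateExt R C' (ModuleCat.of R (TensorProduct R M ω)) ((d : ℤ) - i - 1)) →ₗ[R] E)) := by
  have hnt := nontriv_of ω hω₃
  have hcan : Can R ω d :=
    { fin := finInj_of ω hω₂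
      e := hω₃
      dim := hd
      xs := depth_attained d hω₁
      ys := depth_attained d hCM }
  have henv : Env R E := ⟨hE.1, hE.2⟩
  have hR : Good (R := R) ω R := good_R hω₃.some hcan.self
  have : Module.Finite R (ModuleCat.of R M) := inferInstanceAs (Module.Finite R M)
  have : Module.Finite R (ModuleCat.of R N) := inferInstanceAs (Module.Finite R N)
  obtain ⟨m, ⟨e⟩⟩ := exists_syz C
  obtain ⟨b, ⟨e'⟩⟩ := exists_syz C'
  -- left side
  have hA : ∀ j j' n : ℤ, j = j' + 1 → n = j' + b →
      Nonempty (TateExt R C (ModuleCat.of R N) j ≃ₗ[R]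
        EX R ((taOf C).Q n) ((taOf C').Q (b : ℤ)) 1) := by
    intro j j' n h1 h2
    obtain ⟨e1⟩ := tate C N j' j h1
    obtain ⟨e2⟩ := phi2 (taOf C) (syzOf C') b j' n h2
    exact ⟨e1.trans (e2.trans (postEquiv _ e' 1).symm)⟩
  have hfl : ∀ n : ℤ, IsFiniteLength R (EX R ((taOf C).Q n) ((taOf C').Q (b : ℤ)) 1) := by
    intro n
    obtain ⟨f⟩ := hA (n - b + 1) (n - b) n rfl (by ring)
    exact f.isFiniteLength (hlen _)
  obtain ⟨f1⟩ := hA i (i - 1) (i - 1 + b) (by ring) rfl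
  obtain ⟨f2⟩ := phi3 hcan.fin d (taOf C) (N := (taOf C').Q (b : ℤ))
    (fun j => (taOf C').ext_inj hcan.fin b j)
    (fun n j hj => hcan.ext_ne (hfl n) j hj) (i - 1 + b - d) (i - 1 + b) (by ring)
  obtain ⟨f3⟩ := tate C' (TensorProduct R M ω) ((d : ℤ) - i - 2) ((d : ℤ) - i - 1) (by ring)
  obtain ⟨f4⟩ := phi5 hcan.fin hR hcan.ann (taOf C) (taOf C') (syzOf C) m e ((d : ℤ) - i - 2)
  obtain ⟨f5⟩ := phi4 (taOf C) (taOf C') hcan.fin ((d : ℤ) - i - 2 + m) m b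
    (i - 1 + b - d + 1 + 1 + 1) (by ring)
  obtain ⟨f6⟩ := hcan.dual henv (hfl (i - 1 + b))
  obtain ⟨f7⟩ := henv.bidual (hfl (i - 1 + b))
  have g : TateExt R C' (ModuleCat.of R (TensorProduct R M ω)) ((d : ℤ) - i - 1) ≃ₗ[R]
      (EX R ((taOf C).Q (i - 1 + b)) ((taOf C').Q (b : ℤ)) 1 →ₗ[R] E) :=
    f3.trans (f4.trans (f5.trans (f2.symm.trans f6)))
  exact ⟨f1.trans (f7.trans (LinearEquiv.congrLeft E R g.symm))⟩

end partF
end ARD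

/-- **Generalized Auslander–Reiten duality.** Let `(R,m,k)` be a Cohen–Macaulay local ring
of dimension `d` with canonical module `ω`. If `M`, `N` are finitely generated `R`-modules
of finite Gorenstein dimension such that `Êxt^i_R(M,N)` has finite length for all `i`,
then `Êxt^i_R(M,N) ≅ Hom_R(Êxt^{d-i-1}_R(N, M ⊗_R ω), E_R(k))` for all `i ∈ ℤ`. -/
theorem stmt_5 (R : Type) [CommRing R] [IsNoetherianRing R] [IsLocalRing R]
    (d : ℕ) (hd : ringKrullDim R = d) (hCM : moduleDepth R R = d)
    (ω : Type) [AddCommGroup ω] [Module R ω] [Module.Finite R ω]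
    (hω₁ : moduleDepth R ω = d) (hω₂ : HasFiniteInjDim R (ModuleCat.of R ω))
    (hω₃ : Nonempty ((ω →ₗ[R] ω) ≃ₗ[R] R))
    (M N : Type) [AddCommGroup M] [Module R M] [Module.Finite R M]
    [AddCommGroup N] [Module R N] [Module.Finite R N]
    (hM : HasFiniteGDim R (ModuleCat.of R M)) (hN : HasFiniteGDim R (ModuleCat.of R N))
    (E : Type) [AddCommGroup E] [Module R E] (hE : IsInjectiveEnvelopeOfResidueField R E)
    (hlen : ∀ (C : CompleteResolution R (ModuleCat.of R M)) (i : ℤ),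
      IsFiniteLength R (TateExt R C (ModuleCat.of R N) i))
    (C : CompleteResolution R (ModuleCat.of R M))
    (C' : CompleteResolution R (ModuleCat.of R N)) (i : ℤ) :
    Nonempty ((TateExt R C (ModuleCat.of R N) i) ≃ₗ[R]
      ((TateExt R C' (ModuleCat.of R (TensorProduct R M ω)) ((d : ℤ) - i - 1)) →ₗ[R] E)) := by
  exact ARD.ar_main d hd hCM ω hω₁ hω₂ hω₃ M N E hE C C' (fun i => hlen C i) i

end
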